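/- Let F be a field of characteristic 2 and n ≥ 1 an integer. Let φ be an anisotropic quadratic form over F of type (1,s) with dim φ = 2ⁿ+1, and let ψ be an anisotropic quadratic form over F of type (1,s') with dim ψ > 2ⁿ+1. Then the scalar extension φ_{F(ψ)} of φ to the function field F(ψ) is anisotropic. -/

import Mathlib

open QuadraticMap MvPolynomial
open scoped TensorProduct

set_option synthInstance.maxHeartbeats 1000000
set_option maxHeartbeats 1000000


section Defs

variable {K : Type} [CommRing K]

/-- The binary quadratic form `[a,b] : (x,y) ↦ a·x² + x·y + b·y²`. -/
noncomputable def binQF (a b : K) : QuadraticForm K (Fin 2 → K) :=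
  (Matrix.of ![![a, 1], ![0, b]]).toQuadraticMap'

/-- The diagonal (totally singular) quadratic form `⟨c₁, …, c_s⟩`. -/
noncomputable def diagQF {s : ℕ} (c : Fin s → K) : QuadraticForm K (Fin s → K) :=
  QuadraticMap.weightedSumSquares K c

/-- The orthogonal sum `[a₁,b₁] ⊥ ⋯ ⊥ [a_r,b_r]` of binary forms. -/
noncomputable def binsQF {r : ℕ} (a b : Fin r → K) : QuadraticForm K (Fin r → Fin 2 → K) :=
  QuadraticMap.pi fun i => binQF (a i) (b i)

/-- The orthogonal sum of `m` hyperbolic planes `[0,0]`. -/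
noncomputable def hypQF (K : Type) [CommRing K] (m : ℕ) :
    QuadraticForm K (Fin m → Fin 2 → K) :=
  binsQF (fun _ => 0) (fun _ => 0)

/-- The `(n+1)`-fold quadratic Pfister form `⟨⟨a₁,…,aₙ⟩⟩_b ⊗ [1,c]`, i.e. the orthogonal
sum over all subsets `S ⊆ {1,…,n}` of `(∏_{i∈S} aᵢ)·[1,c]`. -/
noncomputable def pfisterQF (n : ℕ) (a : Fin n → K) (c : K) :
    QuadraticForm K (Finset (Fin n) → Fin 2 → K) :=
  QuadraticMap.pi fun S : Finset (Fin n) => (∏ i ∈ S, a i) • binQF 1 c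

variable {V W : Type} [AddCommGroup V] [Module K V] [AddCommGroup W] [Module K W]

/-- `φ` has type `(r,s)`: it is isometric to `[a₁,b₁] ⊥ ⋯ ⊥ [a_r,b_r] ⊥ ⟨c₁,…,c_s⟩`. -/
def HasTypeRS (φ : QuadraticForm K V) (r s : ℕ) : Prop :=
  ∃ (a b : Fin r → K) (c : Fin s → K), φ.Equivalent ((binsQF a b).prod (diagQF c))

/-- `φ` is dominated by `ψ`. -/
def Dominated (φ : QuadraticForm K V) (ψ : QuadraticForm K W) : Prop :=
  ∃ f : V →ₗ[K] W, Function.Injective f ∧ ∀ v, φ v = ψ (f v)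

/-- `φ` is weakly dominated by `ψ`: `α·φ` is dominated by `ψ` for some unit `α`. -/
def WeaklyDominated (φ : QuadraticForm K V) (ψ : QuadraticForm K W) : Prop :=
  ∃ α : Kˣ, Dominated ((α : K) • φ) ψ

/-- Witt equivalence of quadratic forms. -/
def WittEquiv (Q₁ : QuadraticForm K V) (Q₂ : QuadraticForm K W) : Prop :=
  ∃ k l : ℕ, (Q₁.prod (hypQF K k)).Equivalent (Q₂.prod (hypQF K l))

/-- `φ` is a Pfister neighbour: there is a quadratic Pfister form `π` with
`2·dim φ > dim π` and `φ ≺_w π`. -/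
def IsPfisterNeighbour (φ : QuadraticForm K V) : Prop :=
  ∃ (n : ℕ) (a : Fin n → Kˣ) (c : K),
    2 * Module.finrank K V > 2 ^ (n + 1) ∧
      WeaklyDominated φ (pfisterQF n (fun i => (a i : K)) c)

/-- The Artin–Schreier set `℘(K) = {t² + t : t ∈ K}`. -/
def ArtinSchreier (K : Type) [CommRing K] : Set K := {x : K | ∃ t : K, x = t ^ 2 + t}

end Defs

section FunField

variable (F : Type) [Field F]

/-- The coefficient matrix of a quadratic form on `Fin n → F` with respect to the
standard basis: diagonal entries `ψ(eᵢ)`, above-diagonal entries `b_ψ(eᵢ,eⱼ)`. -/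
noncomputable def coeffMat {n : ℕ} (ψ : QuadraticForm F (Fin n → F)) :
    Matrix (Fin n) (Fin n) F :=
  Matrix.of fun i j =>
    if i = j then ψ (Pi.single i 1)
    else if i < j then polar ψ (Pi.single i 1) (Pi.single j 1) else 0

/-- The homogeneous degree 2 polynomial `P_ψ` associated to a quadratic form `ψ`. -/
noncomputable def qfPoly {n : ℕ} (ψ : QuadraticForm F (Fin n → F)) :
    MvPolynomial (Fin n) F :=
  ∑ i : Fin n, ∑ j : Fin n, MvPolynomial.C (coeffMat F ψ i j) * (X i * X j)

/-- The affine coordinate ring `F[x₁,…,xₙ]/(P_ψ)` of the quadric `ψ = 0`. -/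
def FunFieldRing {n : ℕ} (ψ : QuadraticForm F (Fin n → F)) : Type :=
  MvPolynomial (Fin n) F ⧸ Ideal.span {qfPoly F ψ}

noncomputable instance {n : ℕ} (ψ : QuadraticForm F (Fin n → F)) :
    CommRing (FunFieldRing F ψ) :=
  inferInstanceAs (CommRing (MvPolynomial (Fin n) F ⧸ Ideal.span {qfPoly F ψ}))

noncomputable instance {n : ℕ} (ψ : QuadraticForm F (Fin n → F)) :
    Algebra F (FunFieldRing F ψ) :=
  inferInstanceAs (Algebra F (MvPolynomial (Fin n) F ⧸ Ideal.span {qfPoly F ψ}))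

/-- The function field `F(ψ)` of the quadric `ψ = 0`. -/
def FunField {n : ℕ} (ψ : QuadraticForm F (Fin n → F)) : Type :=
  FractionRing (FunFieldRing F ψ)

noncomputable instance {n : ℕ} (ψ : QuadraticForm F (Fin n → F)) :
    CommRing (FunField F ψ) :=
  inferInstanceAs (CommRing (FractionRing (FunFieldRing F ψ)))

noncomputable instance {n : ℕ} (ψ : QuadraticForm F (Fin n → F)) :
    Algebra (FunFieldRing F ψ) (FunField F ψ) :=
  inferInstanceAs (Algebra (FunFieldRing F ψ) (FractionRing (FunFieldRing F ψ)))

noncomputable instance {n : ℕ} (ψ : QuadraticForm F (Fin n → F)) :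
    Algebra F (FunField F ψ) :=
  inferInstanceAs (Algebra F (FractionRing (FunFieldRing F ψ)))

/-- The canonical map `F → F(ψ)`. -/
noncomputable def funFieldMap {n : ℕ} (ψ : QuadraticForm F (Fin n → F)) :
    F →+* FunField F ψ :=
  algebraMap F (FunField F ψ)

/-- Scalar extension of a quadratic form on `Fin n → F` along a ring homomorphism
`f : F → K`. -/
noncomputable def extendQF {K : Type} [CommRing K] (f : F →+* K) {n : ℕ}
    (φ : QuadraticForm F (Fin n → F)) : QuadraticForm K (Fin n → K) :=
  ((coeffMat F φ).map f).toQuadraticMap'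

end FunField


section Quat

variable (K : Type) [CommRing K]

/-- Defining relations for the char-2 quaternion algebra `[a,b)`: generators `i,j` with
`i² + i = a`, `j² = b`, `j·i = i·j + j` (i.e. `j·i·j⁻¹ = i + 1`). -/
inductive QuatRel (a b : K) : FreeAlgebra K (Fin 2) → FreeAlgebra K (Fin 2) → Prop
  | i_sq : QuatRel a b (FreeAlgebra.ι K 0 * FreeAlgebra.ι K 0 + FreeAlgebra.ι K 0)
      (algebraMap K _ a)
  | j_sq : QuatRel a b (FreeAlgebra.ι K 1 * FreeAlgebra.ι K 1) (algebraMap K _ b)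
  | swap : QuatRel a b (FreeAlgebra.ι K 1 * FreeAlgebra.ι K 0)
      (FreeAlgebra.ι K 0 * FreeAlgebra.ι K 1 + FreeAlgebra.ι K 1)

/-- The quaternion algebra `[a,b)` over `K` (characteristic two convention). -/
def QuatAlg (a b : K) : Type := RingQuot (QuatRel K a b)

noncomputable instance (a b : K) : Ring (QuatAlg K a b) :=
  inferInstanceAs (Ring (RingQuot (QuatRel K a b)))
noncomputable instance (a b : K) : Algebra K (QuatAlg K a b) :=
  inferInstanceAs (Algebra K (RingQuot (QuatRel K a b)))

/-- `[a,b)` is split over `K`: isomorphic to the `2×2` matrix algebra. -/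
def QuatSplit (a b : K) : Prop :=
  Nonempty (QuatAlg K a b ≃ₐ[K] Matrix (Fin 2) (Fin 2) K)

end Quat

section Sqrt

variable (F : Type) [Field F]

/-- The field `F(√c₁,…,√c_s)` obtained by adjoining square roots of the `cᵢ`
(inside an algebraic closure of `F`). -/
noncomputable def sqrtExt {s : ℕ} (c : Fin s → F) :
    IntermediateField F (AlgebraicClosure F) :=
  IntermediateField.adjoin F
    {y : AlgebraicClosure F | ∃ i, y ^ 2 = algebraMap F (AlgebraicClosure F) (c i)}

/-- The subfield `F² = {x² : x ∈ F}` of squares of a field of characteristic 2. -/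
noncomputable def sqSubfield : Subfield F := Subfield.closure (Set.range fun x : F => x ^ 2)

set_option synthInstance.maxHeartbeats 1000000 in
/-- The norm degree `[F²(cᵢ·cⱼ) : F²]` of a diagonal form `⟨c₁,…,c_s⟩`. -/
noncomputable def normDegree {s : ℕ} (c : Fin s → F) : ℕ :=
  Module.finrank (sqSubfield F)
    (IntermediateField.adjoin (sqSubfield F)
      (Set.range fun p : Fin s × Fin s => c p.1 * c p.2))

end Sqrt

/-- A ring is a division algebra if it is nontrivial and every nonzero element is a unit. -/
def IsDivisionAlgebra (T : Type) [Ring T] : Prop :=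
  (0 : T) ≠ 1 ∧ ∀ x : T, x ≠ 0 → IsUnit x

namespace MatForm

section Basic

variable {R : Type*} [CommRing R] {ι : Type*} [Fintype ι]

/-- The value at `x` of the quadratic form with coefficient matrix `A`. -/
def quad (A : Matrix ι ι R) (x : ι → R) : R := ∑ i, ∑ j, A i j * x i * x j

/-- The polar form of `quad A`. -/
def pol (A : Matrix ι ι R) (x y : ι → R) : R :=
  ∑ i, ∑ j, A i j * (x i * y j + y i * x j)

theorem quad_add (A : Matrix ι ι R) (x y : ι → R) :
    quad A (x + y) = quad A x + quad A y + pol A x y := by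
  simp only [quad, pol, ← Finset.sum_add_distrib, Pi.add_apply]
  refine Finset.sum_congr rfl fun i _ => Finset.sum_congr rfl fun j _ => ?_
  ring

theorem quad_smul (A : Matrix ι ι R) (c : R) (x : ι → R) :
    quad A (c • x) = c ^ 2 * quad A x := by
  simp only [quad, Finset.mul_sum, Pi.smul_apply, smul_eq_mul]
  refine Finset.sum_congr rfl fun i _ => Finset.sum_congr rfl fun j _ => ?_
  ring

@[simp] theorem quad_zero (A : Matrix ι ι R) : quad A 0 = 0 := by simp [quad]

theorem pol_comm (A : Matrix ι ι R) (x y : ι → R) : pol A x y = pol A y x := by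
  simp only [pol]
  refine Finset.sum_congr rfl fun i _ => Finset.sum_congr rfl fun j _ => ?_
  ring

theorem pol_add_left (A : Matrix ι ι R) (x x' y : ι → R) :
    pol A (x + x') y = pol A x y + pol A x' y := by
  simp only [pol, ← Finset.sum_add_distrib, Pi.add_apply]
  refine Finset.sum_congr rfl fun i _ => Finset.sum_congr rfl fun j _ => ?_
  ring

theorem pol_smul_left (A : Matrix ι ι R) (c : R) (x y : ι → R) :
    pol A (c • x) y = c * pol A x y := by
  simp only [pol, Finset.mul_sum, Pi.smul_apply, smul_eq_mul]
  refine Finset.sum_congr rfl fun i _ => Finset.sum_congr rfl fun j _ => ?_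
  ring

theorem pol_add_right (A : Matrix ι ι R) (x y y' : ι → R) :
    pol A x (y + y') = pol A x y + pol A x y' := by
  rw [pol_comm, pol_add_left, pol_comm A y, pol_comm A y']

theorem pol_smul_right (A : Matrix ι ι R) (c : R) (x y : ι → R) :
    pol A x (c • y) = c * pol A x y := by
  rw [pol_comm, pol_smul_left, pol_comm]

theorem pol_self (A : Matrix ι ι R) (x : ι → R) : pol A x x = 2 * quad A x := by
  simp only [pol, quad, Finset.mul_sum]
  refine Finset.sum_congr rfl fun i _ => Finset.sum_congr rfl fun j _ => ?_
  ring

/-- The polar form of `quad A` as a bilinear form. -/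
def polBilin (A : Matrix ι ι R) : LinearMap.BilinForm R (ι → R) :=
  LinearMap.mk₂ R (pol A) (pol_add_left A) (pol_smul_left A) (pol_add_right A)
    (pol_smul_right A)

@[simp] theorem polBilin_apply (A : Matrix ι ι R) (x y : ι → R) :
    polBilin A x y = pol A x y := rfl

@[simp] theorem pol_zero_left (A : Matrix ι ι R) (y : ι → R) : pol A 0 y = 0 := by
  simp [pol]

@[simp] theorem pol_zero_right (A : Matrix ι ι R) (y : ι → R) : pol A y 0 = 0 := by
  simp [pol]

theorem pol_sum_left (A : Matrix ι ι R) {κ : Type*} (s : Finset κ) (v : κ → ι → R)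
    (y : ι → R) : pol A (∑ k ∈ s, v k) y = ∑ k ∈ s, pol A (v k) y := by
  have h := map_sum ((polBilin A).flip y) v s
  exact h

theorem pol_sum_right (A : Matrix ι ι R) {κ : Type*} (s : Finset κ) (v : κ → ι → R)
    (y : ι → R) : pol A y (∑ k ∈ s, v k) = ∑ k ∈ s, pol A y (v k) := by
  have h := map_sum (polBilin A y) v s
  exact h

variable {S : Type*} [CommRing S]

theorem quad_map (f : R →+* S) (A : Matrix ι ι R) (x : ι → R) :
    quad (A.map f) (f ∘ x) = f (quad A x) := by
  simp [quad]

theorem pol_map (f : R →+* S) (A : Matrix ι ι R) (x y : ι → R) :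
    pol (A.map f) (f ∘ x) (f ∘ y) = f (pol A x y) := by
  simp [pol]

/-- Linear combinations of two families with the same values and polar values agree. -/
theorem quad_sum_congr {ι' κ : Type*} [Fintype ι'] {A : Matrix ι ι R} {B : Matrix ι' ι' R}
    {s : Finset κ} {v : κ → ι → R} {w : κ → ι' → R}
    (hq : ∀ k ∈ s, quad A (v k) = quad B (w k))
    (hp : ∀ k ∈ s, ∀ l ∈ s, pol A (v k) (v l) = pol B (w k) (w l)) (r : κ → R) :
    quad A (∑ k ∈ s, r k • v k) = quad B (∑ k ∈ s, r k • w k) := by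
  classical
  induction s using Finset.induction_on with
  | empty => simp
  | insert a s ha ih =>
    rw [Finset.sum_insert ha, Finset.sum_insert ha, quad_add, quad_add, quad_smul, quad_smul,
      hq a (by simp), ih (fun k hk => hq k (by simp [hk]))
        (fun k hk l hl => hp k (by simp [hk]) l (by simp [hl])), pol_sum_right, pol_sum_right]
    congr 1
    refine Finset.sum_congr rfl fun k hk => ?_
    rw [pol_smul_left, pol_smul_left, pol_smul_right, pol_smul_right,
      hp a (by simp) k (by simp [hk])]

/-- The form `quad A` has no nontrivial zero. -/
def IsAniso (A : Matrix ι ι R) : Prop := ∀ x, quad A x = 0 → x = 0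

end Basic

theorem map_ratFuncC {ι K : Type*} [Field K] (A : Matrix ι ι K) :
    A.map (RatFunc.C : K →+* RatFunc K) =
      (A.map (Polynomial.C : K →+* Polynomial K)).map (algebraMap _ (RatFunc K)) := by
  ext i j
  simp

section Poly

variable {K : Type*} [Field K] {ι : Type*} [Fintype ι]

theorem coeff_quad_polynomial (A : Matrix ι ι K) (u : ι → Polynomial K) (d : ℕ)
    (hu : ∀ i, (u i).natDegree ≤ d) :
    (quad (A.map Polynomial.C) u).coeff (d + d) = quad A fun i => (u i).coeff d := by
  simp only [quad, Polynomial.finsetSum_coeff, Matrix.map_apply]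
  refine Finset.sum_congr rfl fun i _ => Finset.sum_congr rfl fun j _ => ?_
  rw [mul_assoc, Polynomial.coeff_C_mul, Polynomial.coeff_mul_add_eq_of_natDegree_le (hu i) (hu j),
    mul_assoc]

theorem natDegree_quad_le (A : Matrix ι ι K) (u : ι → Polynomial K) (d : ℕ)
    (hu : ∀ i, (u i).natDegree ≤ d) : (quad (A.map Polynomial.C) u).natDegree ≤ d + d := by
  refine Polynomial.natDegree_sum_le_of_forall_le _ _ fun i _ =>
    Polynomial.natDegree_sum_le_of_forall_le _ _ fun j _ => ?_
  rw [Matrix.map_apply, mul_assoc]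
  exact (Polynomial.natDegree_C_mul_le _ _).trans
    (Polynomial.natDegree_mul_le.trans (add_le_add (hu i) (hu j)))

/-- For an anisotropic form the degree of a value is twice the degree of the vector. -/
theorem exists_natDegree_quad {A : Matrix ι ι K} (hA : IsAniso A) {u : ι → Polynomial K}
    (hu : u ≠ 0) : ∃ d, (∀ i, (u i).natDegree ≤ d) ∧ quad (A.map Polynomial.C) u ≠ 0 ∧
      (quad (A.map Polynomial.C) u).natDegree = d + d := by
  classical
  obtain ⟨i₀, hi₀⟩ := Function.ne_iff.1 hu
  obtain ⟨k, hk0, hk⟩ : ∃ k, u k ≠ 0 ∧ ∀ i, (u i).natDegree ≤ (u k).natDegree := by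
    obtain ⟨k, hk0, hk⟩ := Finset.exists_max_image
      (Finset.univ.filter fun i => u i ≠ 0) (fun i => (u i).natDegree) ⟨i₀, by simpa using hi₀⟩
    refine ⟨k, by simpa using hk0, fun i => ?_⟩
    by_cases h : u i = 0
    · simp [h]
    · exact hk i (by simpa using h)
  have hc := coeff_quad_polynomial A u _ hk
  have hne : (quad (A.map Polynomial.C) u).coeff ((u k).natDegree + (u k).natDegree) ≠ 0 := by
    rw [hc]
    intro h
    exact hk0 (Polynomial.leadingCoeff_eq_zero.1 (congrFun (hA _ h) k))
  exact ⟨_, hk, fun h => hne (by simp [h]),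
    le_antisymm (natDegree_quad_le A u _ hk) (Polynomial.le_natDegree_of_ne_zero hne)⟩

theorem IsAniso.map_C {A : Matrix ι ι K} (hA : IsAniso A) :
    IsAniso (A.map (Polynomial.C : K →+* Polynomial K)) := fun u hu => by
  by_contra h
  obtain ⟨d, -, h0, -⟩ := exists_natDegree_quad hA h
  exact h0 hu

/-- Clearing denominators in a vector of rational functions. -/
theorem exists_smul_eq_algebraMap (u : ι → RatFunc K) :
    ∃ (h : Polynomial K) (f : ι → Polynomial K), h ≠ 0 ∧
      ∀ i, algebraMap _ (RatFunc K) h * u i = algebraMap _ _ (f i) := by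
  classical
  obtain ⟨b, hb⟩ := IsLocalization.exist_integer_multiples_of_finite
    (nonZeroDivisors (Polynomial K)) u
  choose f hf using hb
  refine ⟨b, f, nonZeroDivisors.coe_ne_zero b, fun i => ?_⟩
  rw [hf i, Algebra.smul_def]

/-- Anisotropy is preserved by a purely transcendental extension. -/
theorem IsAniso.map_ratFunc {A : Matrix ι ι K} (hA : IsAniso A) :
    IsAniso (A.map (RatFunc.C : K →+* RatFunc K)) := fun u hu => by
  obtain ⟨h, f, hh, hf⟩ := exists_smul_eq_algebraMap u
  have hf' : algebraMap (Polynomial K) (RatFunc K) h • u = algebraMap _ _ ∘ f :=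
    funext fun i => hf i
  have h1 : quad (A.map Polynomial.C) f = 0 := by
    apply RatFunc.algebraMap_injective K
    rw [← quad_map, ← hf', ← map_ratFuncC, quad_smul, hu, mul_zero, map_zero]
  have h2 := hA.map_C f h1
  funext i
  have := hf i
  rw [h2] at this
  simpa [hh] using this

end Poly

section CasselsPfister

variable {K : Type*} [Field K] {ι : Type*} [Fintype ι]

theorem natDegree_pol_C_lt (A : Matrix ι ι K) (u : ι → Polynomial K) (w : ι → K) (N : ℕ)
    (hN : N ≠ 0) (hu : ∀ i, (u i).natDegree < N) :
    (pol (A.map (Polynomial.C : K →+* Polynomial K)) u (Polynomial.C ∘ w)).natDegree < N := by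
  have key : (pol (A.map (Polynomial.C : K →+* Polynomial K)) u
      (Polynomial.C ∘ w)).natDegree ≤ N - 1 := by
    rw [pol]
    refine Polynomial.natDegree_sum_le_of_forall_le _ _ fun i _ =>
      Polynomial.natDegree_sum_le_of_forall_le _ _ fun j _ => ?_
    rw [Matrix.map_apply]
    refine (Polynomial.natDegree_C_mul_le _ _).trans ((Polynomial.natDegree_add_le _ _).trans ?_)
    exact max_le ((Polynomial.natDegree_mul_C_le _ _).trans (Nat.le_sub_one_of_lt (hu i)))
      ((Polynomial.natDegree_C_mul_le _ _).trans (Nat.le_sub_one_of_lt (hu j)))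
  exact key.trans_lt (Nat.sub_one_lt hN)

/-- The Cassels–Pfister descent, with prescribed polar values against constant vectors. -/
theorem cassels_pfister_polynomial {A : Matrix ι ι K} (hA : IsAniso A) {J : Type*}
    (w : J → ι → K) (c : Polynomial K) (d : J → Polynomial K) (N : ℕ) :
    ∀ (h : Polynomial K) (f : ι → Polynomial K), h ≠ 0 → h.natDegree = N →
      quad (A.map Polynomial.C) f = h ^ 2 * c →
      (∀ j, pol (A.map (Polynomial.C : K →+* Polynomial K)) f (Polynomial.C ∘ w j) = h * d j) →
      ∃ g, quad (A.map Polynomial.C) g = c ∧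
        ∀ j, pol (A.map (Polynomial.C : K →+* Polynomial K)) g (Polynomial.C ∘ w j) = d j := by
  induction N using Nat.strong_induction_on with
  | _ N ih =>
    intro h f hh hN hq hp
    set B := A.map (Polynomial.C : K →+* Polynomial K) with hB
    set g : ι → Polynomial K := fun i => f i / h
    set ρ : ι → Polynomial K := fun i => f i % h
    have hf : f = h • g + ρ := funext fun i => (EuclideanDomain.div_add_mod (f i) h).symm
    by_cases hρ : ρ = 0
    · rw [hρ, add_zero] at hf
      refine ⟨g, ?_, fun j => ?_⟩
      · rw [hf, quad_smul] at hq
        exact mul_left_cancel₀ (pow_ne_zero 2 hh) hq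
      · have := hp j
        rw [hf, pol_smul_left] at this
        exact mul_left_cancel₀ hh this
    · have hN0 : N ≠ 0 := by
        rintro rfl
        refine hρ (funext fun i => ?_)
        have hu : IsUnit h := Polynomial.isUnit_iff_degree_eq_zero.2
          (by rw [Polynomial.degree_eq_natDegree hh, hN]; rfl)
        exact EuclideanDomain.mod_eq_zero.2 hu.dvd
      have hρd : ∀ i, (ρ i).natDegree < N := fun i => by
        rw [← hN]; exact Polynomial.natDegree_mod_lt _ (by omega)
      have hρw : ∀ j, pol B ρ (Polynomial.C ∘ w j) = 0 ∧ pol B g (Polynomial.C ∘ w j) = d j := by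
        intro j
        have h1 := hp j
        rw [hf, pol_add_left, pol_smul_left] at h1
        have h2 : pol B ρ (Polynomial.C ∘ w j) = 0 := by
          by_contra hne
          have hdvd : h ∣ pol B ρ (Polynomial.C ∘ w j) :=
            ⟨d j - pol B g (Polynomial.C ∘ w j), by linear_combination h1⟩
          have := Polynomial.natDegree_le_of_dvd hdvd hne
          have h3 := natDegree_pol_C_lt A ρ (w j) N hN0 hρd
          rw [← hB] at h3
          omega
        refine ⟨h2, mul_left_cancel₀ hh ?_⟩
        rw [h2, add_zero] at h1
        exact h1
      set h' := h * (c - quad B g) - pol B g ρ with hh'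
      have hqρ : quad B ρ = h * h' := by
        rw [hf, quad_add, quad_smul, pol_smul_left] at hq
        rw [hh']
        linear_combination hq
      have hqρ0 : quad B ρ ≠ 0 := fun h0 => hρ (hA.map_C ρ h0)
      have hh'0 : h' ≠ 0 := fun h0 => hqρ0 (by rw [hqρ, h0, mul_zero])
      have hdeg : h'.natDegree < N := by
        have h1 := natDegree_quad_le A ρ (N - 1) fun i => by have := hρd i; omega
        rw [← hB, hqρ, Polynomial.natDegree_mul hh hh'0] at h1
        omega
      refine ih _ hdeg h' (h' • g + (quad B g - c) • ρ) hh'0 rfl ?_ fun j => ?_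
      · rw [quad_add, quad_smul, quad_smul, pol_smul_left, pol_smul_right, hqρ]
        have : pol B g ρ = h * (c - quad B g) - h' := by rw [hh']; ring
        rw [this]
        ring
      · rw [pol_add_left, pol_smul_left, pol_smul_left, (hρw j).1, (hρw j).2]
        ring

theorem quad_add_X_smul (A : Matrix ι ι K) (u₀ u₁ : ι → K) :
    quad (A.map (Polynomial.C : K →+* Polynomial K))
      (Polynomial.C ∘ u₀ + (Polynomial.X : Polynomial K) • (Polynomial.C ∘ u₁)) =
      Polynomial.C (quad A u₀) + Polynomial.C (pol A u₀ u₁) * Polynomial.X +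
        Polynomial.C (quad A u₁) * Polynomial.X ^ 2 := by
  rw [quad_add, quad_smul, pol_smul_right, quad_map, quad_map, pol_map]
  ring

theorem coeff_quadratic (a b c : K) :
    (Polynomial.C a + Polynomial.C b * Polynomial.X + Polynomial.C c * Polynomial.X ^ 2).coeff 0
      = a ∧
    (Polynomial.C a + Polynomial.C b * Polynomial.X + Polynomial.C c * Polynomial.X ^ 2).coeff 1
      = b ∧
    (Polynomial.C a + Polynomial.C b * Polynomial.X + Polynomial.C c * Polynomial.X ^ 2).coeff 2
      = c := by
  refine ⟨?_, ?_, ?_⟩ <;> simp [Polynomial.coeff_X, Polynomial.coeff_C]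

/-- If an anisotropic form represents a polynomial of degree at most two over the rational
function field, with affine polar values against constant vectors, then it does so by a vector
of the form `u₀ + t u₁` with constant `u₀`, `u₁`. -/
theorem cassels_pfister {A : Matrix ι ι K} (hA : IsAniso A) {J : Type*}
    (w : J → ι → K) (c₀ c₁ c₂ : K) (d e : J → K) (u : ι → RatFunc K)
    (hq : quad (A.map (RatFunc.C : K →+* RatFunc K)) u =
      RatFunc.C c₀ + RatFunc.C c₁ * RatFunc.X + RatFunc.C c₂ * RatFunc.X ^ 2)
    (hp : ∀ j, pol (A.map (RatFunc.C : K →+* RatFunc K)) u (RatFunc.C ∘ w j) =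
      RatFunc.C (d j) + RatFunc.C (e j) * RatFunc.X) :
    ∃ u₀ u₁ : ι → K, quad A u₀ = c₀ ∧ pol A u₀ u₁ = c₁ ∧ quad A u₁ = c₂ ∧
      ∀ j, pol A u₀ (w j) = d j ∧ pol A u₁ (w j) = e j := by
  obtain ⟨h, f, hh, hf⟩ := exists_smul_eq_algebraMap u
  have hf' : algebraMap (Polynomial K) (RatFunc K) h • u = algebraMap _ _ ∘ f :=
    funext fun i => hf i
  obtain ⟨g, hgq, hgp⟩ := cassels_pfister_polynomial hA w
    (Polynomial.C c₀ + Polynomial.C c₁ * Polynomial.X + Polynomial.C c₂ * Polynomial.X ^ 2)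
    (fun j => Polynomial.C (d j) + Polynomial.C (e j) * Polynomial.X) _ h f hh rfl
    (by
      apply RatFunc.algebraMap_injective K
      rw [← quad_map, ← hf', ← map_ratFuncC, quad_smul, hq]
      simp)
    (fun j => by
      apply RatFunc.algebraMap_injective K
      have hw : (RatFunc.C ∘ w j : ι → RatFunc K) =
          algebraMap (Polynomial K) (RatFunc K) ∘ (Polynomial.C ∘ w j) := by
        ext i; simp
      rw [← pol_map, ← hf', ← map_ratFuncC, pol_smul_left, ← hw, hp]
      simp)
  have hdeg : ∀ i, (g i).natDegree ≤ 1 := by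
    by_cases hg : g = 0
    · simp [hg]
    · obtain ⟨k, hk, -, hk2⟩ := exists_natDegree_quad hA hg
      rw [hgq] at hk2
      have : (Polynomial.C c₀ + Polynomial.C c₁ * Polynomial.X +
          Polynomial.C c₂ * Polynomial.X ^ 2).natDegree ≤ 2 := by compute_degree
      exact fun i => (hk i).trans (by omega)
  set u₀ : ι → K := fun i => (g i).coeff 0
  set u₁ : ι → K := fun i => (g i).coeff 1
  have hg : g = Polynomial.C ∘ u₀ + (Polynomial.X : Polynomial K) • (Polynomial.C ∘ u₁) := by
    ext1 i
    rw [Polynomial.eq_X_add_C_of_natDegree_le_one (hdeg i)]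
    simp [u₀, u₁]
    ring
  rw [hg, quad_add_X_smul] at hgq
  have h1 := coeff_quadratic (quad A u₀) (pol A u₀ u₁) (quad A u₁)
  have h2 := coeff_quadratic c₀ c₁ c₂
  rw [hgq] at h1
  refine ⟨u₀, u₁, h1.1.symm.trans h2.1, h1.2.1.symm.trans h2.2.1, h1.2.2.symm.trans h2.2.2,
    fun j => ?_⟩
  have h3 := hgp j
  rw [hg, pol_add_left, pol_smul_left, pol_map, pol_map] at h3
  constructor
  · have := congrArg (fun p => p.coeff 0) h3
    simpa using this
  · have := congrArg (fun p => p.coeff 1) h3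
    simpa [Polynomial.coeff_X, Polynomial.coeff_C] using this

end CasselsPfister

section Reflection

variable {K : Type*} [Field K] {ι : Type*} [Fintype ι]

theorem pol_neg_left {R : Type*} [CommRing R] (A : Matrix ι ι R) (x y : ι → R) :
    pol A (-x) y = -pol A x y := by
  have := pol_smul_left A (-1) x y
  simpa using this

theorem pol_sub_left {R : Type*} [CommRing R] (A : Matrix ι ι R) (x x' y : ι → R) :
    pol A (x - x') y = pol A x y - pol A x' y := by
  rw [sub_eq_add_neg, pol_add_left, pol_neg_left, sub_eq_add_neg]

theorem pol_sub_right {R : Type*} [CommRing R] (A : Matrix ι ι R) (x y y' : ι → R) :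
    pol A x (y - y') = pol A x y - pol A x y' := by
  rw [pol_comm, pol_sub_left, pol_comm A y, pol_comm A y']

theorem quad_sub {R : Type*} [CommRing R] (A : Matrix ι ι R) (x y : ι → R) :
    quad A (x - y) = quad A x + quad A y - pol A x y := by
  have h := quad_add A x ((-1 : R) • y)
  rw [quad_smul, pol_smul_right] at h
  have h' : x - y = x + (-1 : R) • y := by simp [sub_eq_add_neg]
  rw [h', h]
  ring

/-- If `q(u) = q(w)`, some vector has the same value as `x`, the same polar values as `x` against
every vector orthogonal to `u - w`, and pairs with `w` as `x` pairs with `u`. -/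
theorem exists_reflection {A : Matrix ι ι K} (hA : IsAniso A) {u w : ι → K}
    (h : quad A u = quad A w) (x : ι → K) :
    ∃ x', quad A x' = quad A x ∧ pol A x' w = pol A x u ∧
      ∀ y, pol A u y = pol A w y → pol A x' y = pol A x y := by
  by_cases hd : u - w = 0
  · exact ⟨x, rfl, by rw [sub_eq_zero.1 hd], fun _ _ => rfl⟩
  · have hq : quad A (u - w) ≠ 0 := fun h0 => hd (hA _ h0)
    set d := u - w with hd'
    set l := pol A x d / quad A d with hl
    have hl' : l * quad A d = pol A x d := div_mul_cancel₀ _ hq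
    have hqd : quad A d = 2 * quad A u - pol A u w := by rw [hd', quad_sub, ← h]; ring
    have hpd : pol A u d = quad A d := by
      rw [hqd, hd', pol_sub_right, pol_self]
    refine ⟨x - l • d, ?_, ?_, fun y hy => ?_⟩
    · rw [quad_sub, quad_smul, pol_smul_right, ← hl']
      ring
    · have hxd : pol A x d = pol A x u - pol A x w := by rw [hd', pol_sub_right]
      have hdw : pol A d w = -quad A d := by
        rw [hqd, hd', pol_sub_left, pol_self, ← h]
        ring
      rw [pol_sub_left, pol_smul_left, hdw]
      linear_combination hl' + hxd
    · rw [pol_sub_left, pol_smul_left, hd', pol_sub_left, hy]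
      ring

end Reflection

section Representation

variable {K : Type} [Field K] {ι κ : Type} [Fintype ι] [Fintype κ]

theorem map_map_ringHom {ι : Type*} {R S T : Type*} [CommRing R] [CommRing S] [CommRing T]
    (A : Matrix ι ι R) (f : R →+* S) (g : S →+* T) : A.map (g.comp f) = (A.map f).map g := by
  ext; rfl

@[simp] theorem map_ringHom_id {ι : Type*} {R : Type*} [CommRing R] (A : Matrix ι ι R) :
    A.map (RingHom.id R) = A := by
  ext; rfl

/-- A substitution principle: if, over a class of extensions closed under adjoining a variable,
`quad A` stays anisotropic and represents all values of `quad B`, then it does so with prescribed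
polar values against an isometrically embedded family. -/
theorem exists_quad_eq_of_represents {A : Matrix ι ι K} {B : Matrix κ κ K}
    (P : ∀ (L : Type) [Field L], (K →+* L) → Prop)
    (hP : ∀ (L : Type) [Field L] (f : K →+* L), P L f →
      P (RatFunc L) ((RatFunc.C : L →+* RatFunc L).comp f))
    (hA : ∀ (L : Type) [Field L] (f : K →+* L), P L f → IsAniso (A.map f))
    (hrep : ∀ (L : Type) [Field L] (f : K →+* L), P L f → ∀ v : κ → L,
      ∃ u, quad (A.map f) u = quad (B.map f) v)
    (S : List ((κ → K) × (ι → K)))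
    (hq : ∀ p ∈ S, quad A p.2 = quad B p.1)
    (hp : ∀ p ∈ S, ∀ p' ∈ S, pol A p.2 p'.2 = pol B p.1 p'.1) :
    ∀ (L : Type) [Field L] (f : K →+* L), P L f → ∀ v : κ → L,
      ∃ u, quad (A.map f) u = quad (B.map f) v ∧
        ∀ p ∈ S, pol (A.map f) u (f ∘ p.2) = pol (B.map f) v (f ∘ p.1) := by
  induction S with
  | nil => exact fun L _ f hf v => (hrep L f hf v).imp fun u hu => ⟨hu, by simp⟩
  | cons p S ih =>
    intro L _ f hf v
    have ih' := ih (fun p' h => hq p' (by simp [h]))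
      (fun p' h p'' h' => hp p' (by simp [h]) p'' (by simp [h']))
    obtain ⟨u, hu, hup⟩ := ih' (RatFunc L) _ (hP L f hf)
      (RatFunc.C ∘ v + (RatFunc.X : RatFunc L) • (RatFunc.C ∘ (f ∘ p.1)))
    rw [map_map_ringHom, map_map_ringHom] at hu
    rw [quad_add, quad_smul, pol_smul_right, quad_map, quad_map, pol_map] at hu
    obtain ⟨u₀, u₁, h0, h01, h1, hw⟩ := cassels_pfister (hA L f hf)
      (fun j : {p // p ∈ S} => f ∘ j.1.2) (quad (B.map f) v) (pol (B.map f) v (f ∘ p.1))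
      (quad (B.map f) (f ∘ p.1)) (fun j => pol (B.map f) v (f ∘ j.1.1))
      (fun j => pol (B.map f) (f ∘ p.1) (f ∘ j.1.1)) u (by rw [hu]; ring)
      (fun j => by
        have := hup j.1 j.2
        rw [map_map_ringHom, map_map_ringHom, RingHom.coe_comp, Function.comp_assoc,
          Function.comp_assoc, pol_add_left, pol_smul_left, pol_map, pol_map] at this
        rw [this]
        ring)
    have h1' : quad (A.map f) u₁ = quad (A.map f) (f ∘ p.2) := by
      rw [h1, quad_map, quad_map, hq p (by simp)]
    obtain ⟨x, hxq, hxp, hx⟩ := exists_reflection (hA L f hf) h1' u₀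
    refine ⟨x, hxq.trans h0, fun p' hp' => ?_⟩
    rcases List.mem_cons.1 hp' with rfl | hS
    · rw [hxp, h01]
    · rw [hx, (hw ⟨p', hS⟩).1]
      rw [(hw ⟨p', hS⟩).2, pol_map, pol_map, hp p (by simp) p' (by simp [hS])]

/-- Under the hypotheses of the substitution principle, every finite family of vectors has an
isometric image. -/
theorem exists_isometric_family {A : Matrix ι ι K} {B : Matrix κ κ K}
    (P : ∀ (L : Type) [Field L], (K →+* L) → Prop)
    (hid : P K (RingHom.id K))
    (hP : ∀ (L : Type) [Field L] (f : K →+* L), P L f →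
      P (RatFunc L) ((RatFunc.C : L →+* RatFunc L).comp f))
    (hA : ∀ (L : Type) [Field L] (f : K →+* L), P L f → IsAniso (A.map f))
    (hrep : ∀ (L : Type) [Field L] (f : K →+* L), P L f → ∀ v : κ → L,
      ∃ u, quad (A.map f) u = quad (B.map f) v)
    {J : Type} [Fintype J] (e : J → κ → K) :
    ∃ w : J → ι → K, (∀ j, quad A (w j) = quad B (e j)) ∧
      ∀ j j', pol A (w j) (w j') = pol B (e j) (e j') := by
  classical
  suffices h : ∀ s : Finset J, ∃ w : J → ι → K, (∀ j ∈ s, quad A (w j) = quad B (e j)) ∧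
      ∀ j ∈ s, ∀ j' ∈ s, pol A (w j) (w j') = pol B (e j) (e j') by
    obtain ⟨w, h1, h2⟩ := h Finset.univ
    exact ⟨w, fun j => h1 j (by simp), fun j j' => h2 j (by simp) j' (by simp)⟩
  intro s
  induction s using Finset.induction_on with
  | empty => exact ⟨0, by simp, by simp⟩
  | insert a s ha ih =>
    obtain ⟨w, h1, h2⟩ := ih
    obtain ⟨u, hu, hup⟩ := exists_quad_eq_of_represents P hP hA hrep
      (s.toList.map fun j => (e j, w j)) (by simpa using h1)
      (by
        intro p hp p' hp'
        simp only [List.mem_map, Finset.mem_toList] at hp hp'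
        obtain ⟨j, hj, rfl⟩ := hp
        obtain ⟨j', hj', rfl⟩ := hp'
        exact h2 j hj j' hj') K _ hid (e a)
    simp only [map_ringHom_id] at hu hup
    have hup' : ∀ j ∈ s, pol A u (w j) = pol B (e a) (e j) := fun j hj =>
      hup (e j, w j) (by simpa using ⟨j, hj, rfl, rfl⟩)
    have hne : ∀ j ∈ s, j ≠ a := fun j hj h => ha (h ▸ hj)
    refine ⟨Function.update w a u, fun j hj => ?_, fun j hj j' hj' => ?_⟩
    · rcases Finset.mem_insert.1 hj with rfl | hj
      · simpa using hu
      · rw [Function.update_of_ne (hne j hj), h1 j hj]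
    · rcases Finset.mem_insert.1 hj with rfl | hk <;>
        rcases Finset.mem_insert.1 hj' with rfl | hk'
      · rw [pol_self, pol_self, Function.update_self, hu]
      · rw [Function.update_self, Function.update_of_ne (hne j' hk'), hup' j' hk']
      · rw [Function.update_self, Function.update_of_ne (hne j hk), pol_comm, hup' j hk,
          pol_comm]
      · rw [Function.update_of_ne (hne j hk), Function.update_of_ne (hne j' hk'), h2 j hk j' hk']

end Representation

section AnisoExt

/-- A field extension over which all anisotropic forms stay anisotropic. -/
def AnisoExt {K L : Type} [Field K] [Field L] (f : K →+* L) : Prop :=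
  ∀ (ι : Type) [Fintype ι] (A : Matrix ι ι K), IsAniso A → IsAniso (A.map f)

variable {K L M : Type} [Field K] [Field L] [Field M]

theorem AnisoExt.id : AnisoExt (RingHom.id K) := fun _ _ A hA => by
  rwa [map_ringHom_id]

theorem AnisoExt.comp {g : L →+* M} {f : K →+* L} (hg : AnisoExt g) (hf : AnisoExt f) :
    AnisoExt (g.comp f) := fun ι _ A hA => by
  rw [map_map_ringHom]
  exact hg ι _ (hf ι A hA)

theorem AnisoExt.ratFuncC : AnisoExt (RatFunc.C : K →+* RatFunc K) :=
  fun _ _ _ hA => hA.map_ratFunc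

/-- Anisotropy descends along field extensions. -/
theorem IsAniso.of_map {ι : Type*} [Fintype ι] {A : Matrix ι ι K} (f : K →+* L)
    (h : IsAniso (A.map f)) : IsAniso A := fun x hx => by
  have := h (f ∘ x) (by rw [quad_map, hx, map_zero])
  funext i
  simpa using congrFun this i

end AnisoExt

section RatFuncLift

variable {K L : Type*} [Field K] [Field L]

/-- The homomorphism out of a rational function field determined by a transcendental element. -/
noncomputable def ratFuncLift (f : K →+* L) (t : L)
    (ht : ∀ p : Polynomial K, p.eval₂ f t = 0 → p = 0) :
    RatFunc K →+* L :=
  IsFractionRing.lift (A := Polynomial K) (g := Polynomial.eval₂RingHom f t)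
    ((injective_iff_map_eq_zero _).2 ht)

theorem ratFuncLift_algebraMap (f : K →+* L) (t : L)
    (ht : ∀ p : Polynomial K, p.eval₂ f t = 0 → p = 0) (p : Polynomial K) :
    ratFuncLift f t ht (algebraMap _ _ p) = p.eval₂ f t :=
  IsFractionRing.lift_algebraMap _ _

@[simp] theorem ratFuncLift_C (f : K →+* L) (t : L)
    (ht : ∀ p : Polynomial K, p.eval₂ f t = 0 → p = 0) (a : K) :
    ratFuncLift f t ht (RatFunc.C a) = f a := by
  rw [← RatFunc.algebraMap_C, ratFuncLift_algebraMap, Polynomial.eval₂_C]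

@[simp] theorem ratFuncLift_X (f : K →+* L) (t : L)
    (ht : ∀ p : Polynomial K, p.eval₂ f t = 0 → p = 0) :
    ratFuncLift f t ht RatFunc.X = t := by
  rw [← RatFunc.algebraMap_X, ratFuncLift_algebraMap, Polynomial.eval₂_X]

theorem ratFuncLift_comp_C (f : K →+* L) (t : L)
    (ht : ∀ p : Polynomial K, p.eval₂ f t = 0 → p = 0) :
    (ratFuncLift f t ht).comp RatFunc.C = f := by
  ext a; simp

/-- A nonconstant rational function is transcendental over the image of any constant field. -/
theorem eq_zero_of_eval₂_ratFunc (f : K →+* L) (t : RatFunc L) (ht : ∀ c, t ≠ RatFunc.C c)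
    (p : Polynomial K) (hp : p.eval₂ ((RatFunc.C : L →+* RatFunc L).comp f) t = 0) : p = 0 := by
  have htr := RatFunc.transcendental_of_ne_C (f := t) (fun ⟨c, hc⟩ => ht c hc)
  rw [transcendental_iff] at htr
  have := htr (p.map f) (by
    rw [Polynomial.aeval_def, Polynomial.eval₂_map]
    exact hp)
  exact (Polynomial.map_eq_zero f).1 this

end RatFuncLift

section Round

variable {K : Type} [Field K] {ι : Type} [Fintype ι]

theorem pol_similar {R : Type*} [CommRing R] {ι κ : Type*} [Fintype ι] [Fintype κ]
    {A : Matrix ι ι R} {B : Matrix κ κ R} {g : (ι → R) → κ → R}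
    (hadd : ∀ x y, g (x + y) = g x + g y) {l : R} (h : ∀ y, quad B (g y) = l * quad A y)
    (x y : ι → R) : pol B (g x) (g y) = l * pol A x y := by
  have h1 := h (x + y)
  rw [hadd, quad_add, quad_add, h, h] at h1
  linear_combination h1

/-- The properties of a quadratic Pfister form with separable quadratic slot `c` used below:
over every extension keeping it anisotropic, the form is round, and there is an operator `J`
with `q(Jv) = c q(v)` and `b(v, Jv) = q(v)`. -/
def PfLike (A : Matrix ι ι K) (c : K) : Prop :=
  ∀ (L : Type) [Field L] (f : K →+* L), IsAniso (A.map f) →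
    (∀ x, x ≠ 0 → ∃ g : (ι → L) →ₗ[L] (ι → L),
      ∀ y, quad (A.map f) (g y) = quad (A.map f) x * quad (A.map f) y) ∧
    ∃ J : (ι → L) →ₗ[L] (ι → L), ∀ v, quad (A.map f) (J v) = f c * quad (A.map f) v ∧
      pol (A.map f) v (J v) = quad (A.map f) v

theorem PfLike.map {A : Matrix ι ι K} {c : K} (h : PfLike A c) {L : Type} [Field L]
    (f : K →+* L) : PfLike (A.map f) (f c) := fun M _ g hg => by
  rw [← map_map_ringHom] at hg ⊢
  exact h M (g.comp f) hg

theorem PfLike.binary (c : K) : PfLike !![1, 1; 0, c] c := fun L _ f _ => by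
  have hq : ∀ x, quad ((!![1, 1; 0, c] : Matrix (Fin 2) (Fin 2) K).map f) x =
      x 0 * x 0 + x 0 * x 1 + f c * x 1 * x 1 := fun x => by
    simp [quad, Fin.sum_univ_two]
  have hp : ∀ x y, pol ((!![1, 1; 0, c] : Matrix (Fin 2) (Fin 2) K).map f) x y =
      2 * x 0 * y 0 + (x 0 * y 1 + y 0 * x 1) + f c * (2 * x 1 * y 1) := fun x y => by
    simp [pol, Fin.sum_univ_two]
    ring
  refine ⟨fun x _ => ⟨Matrix.mulVecLin !![x 0, -(f c * x 1); x 1, x 0 + x 1], fun y => ?_⟩,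
    Matrix.mulVecLin !![0, -f c; 1, 1], fun v => ⟨?_, ?_⟩⟩
  · rw [hq, hq, hq]
    simp [Matrix.mulVec, dotProduct, Fin.sum_univ_two]
    ring
  · rw [hq, hq]
    simp [Matrix.mulVec, dotProduct, Fin.sum_univ_two]
    ring
  · rw [hp, hq]
    simp [Matrix.mulVec, dotProduct, Fin.sum_univ_two]
    ring

/-- The orthogonal sum `q ⊥ α q`. -/
def double {R : Type*} [CommRing R] {ι : Type*} (A : Matrix ι ι R) (α : R) :
    Matrix (ι ⊕ ι) (ι ⊕ ι) R :=
  Matrix.fromBlocks A 0 0 (α • A)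

theorem quad_double {R : Type*} [CommRing R] {ι : Type*} [Fintype ι] (A : Matrix ι ι R) (α : R)
    (x : ι ⊕ ι → R) :
    quad (double A α) x = quad A (x ∘ Sum.inl) + α * quad A (x ∘ Sum.inr) := by
  simp [quad, double, Finset.mul_sum, mul_assoc]

theorem pol_double {R : Type*} [CommRing R] {ι : Type*} [Fintype ι] (A : Matrix ι ι R) (α : R)
    (x y : ι ⊕ ι → R) :
    pol (double A α) x y = pol A (x ∘ Sum.inl) (y ∘ Sum.inl) +
      α * pol A (x ∘ Sum.inr) (y ∘ Sum.inr) := by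
  simp [pol, double, Finset.mul_sum, mul_assoc]

theorem double_map {R S : Type*} [CommRing R] [CommRing S] {ι : Type*}
    (A : Matrix ι ι R) (α : R) (f : R →+* S) :
    (double A α).map f = double (A.map f) (f α) := by
  ext i j
  rcases i with i | i <;> rcases j with j | j <;> simp [double]

/-- The linear map with four given blocks on a doubled coordinate space. -/
def blockMap {R : Type*} [CommRing R] {ι : Type*} (a b c d : (ι → R) →ₗ[R] (ι → R)) :
    (ι ⊕ ι → R) →ₗ[R] (ι ⊕ ι → R) where
  toFun x := Sum.elim (a (x ∘ Sum.inl) + b (x ∘ Sum.inr)) (c (x ∘ Sum.inl) + d (x ∘ Sum.inr))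
  map_add' x y := by
    have h1 : (x + y) ∘ (Sum.inl : ι → ι ⊕ ι) = x ∘ Sum.inl + y ∘ Sum.inl := rfl
    have h2 : (x + y) ∘ (Sum.inr : ι → ι ⊕ ι) = x ∘ Sum.inr + y ∘ Sum.inr := rfl
    rw [h1, h2]
    funext i
    rcases i with i | i <;> simp <;> ring
  map_smul' r x := by
    have h1 : (r • x) ∘ (Sum.inl : ι → ι ⊕ ι) = r • (x ∘ Sum.inl) := rfl
    have h2 : (r • x) ∘ (Sum.inr : ι → ι ⊕ ι) = r • (x ∘ Sum.inr) := rfl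
    rw [h1, h2]
    funext i
    rcases i with i | i <;> simp <;> ring

theorem blockMap_inl {R : Type*} [CommRing R] {ι : Type*} (a b c d : (ι → R) →ₗ[R] (ι → R))
    (x : ι ⊕ ι → R) :
    blockMap a b c d x ∘ Sum.inl = a (x ∘ Sum.inl) + b (x ∘ Sum.inr) := rfl

theorem blockMap_inr {R : Type*} [CommRing R] {ι : Type*} (a b c d : (ι → R) →ₗ[R] (ι → R))
    (x : ι ⊕ ι → R) :
    blockMap a b c d x ∘ Sum.inr = c (x ∘ Sum.inl) + d (x ∘ Sum.inr) := rfl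

theorem IsAniso.of_double {R : Type*} [CommRing R] {ι : Type*} [Fintype ι] {A : Matrix ι ι R}
    {α : R} (h : IsAniso (double A α)) : IsAniso A := fun x hx => by
  have := h (Sum.elim x 0) (by rw [quad_double]; simp [hx])
  funext i
  exact congrFun this (Sum.inl i)

theorem exists_similar_double {L : Type*} [Field L] {ι : Type*} [Fintype ι] {A : Matrix ι ι L}
    {α : L} (hA : IsAniso (double A α))
    (hr : ∀ x, x ≠ 0 → ∃ g : (ι → L) →ₗ[L] (ι → L), ∀ y, quad A (g y) = quad A x * quad A y)
    (x : ι ⊕ ι → L) (hx : x ≠ 0) : ∃ g : (ι ⊕ ι → L) →ₗ[L] (ι ⊕ ι → L),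
      ∀ y, quad (double A α) (g y) = quad (double A α) x * quad (double A α) y := by
  by_cases h2 : x ∘ Sum.inr = 0
  · have h1 : x ∘ Sum.inl ≠ 0 := fun h1 => hx (by
      funext i
      rcases i with i | i
      exacts [congrFun h1 i, congrFun h2 i])
    obtain ⟨g, hg⟩ := hr _ h1
    refine ⟨blockMap g 0 0 g, fun y => ?_⟩
    rw [quad_double, quad_double A α x, quad_double A α y, blockMap_inl, blockMap_inr, h2]
    simp only [LinearMap.zero_apply, add_zero, zero_add, hg, quad_zero, mul_zero]
    ring
  · obtain ⟨g₂, hg₂⟩ := hr _ h2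
    by_cases h1 : x ∘ Sum.inl = 0
    · refine ⟨blockMap 0 (α • g₂) g₂ 0, fun y => ?_⟩
      rw [quad_double, quad_double A α x, quad_double A α y, blockMap_inl, blockMap_inr, h1]
      simp only [LinearMap.zero_apply, LinearMap.smul_apply, add_zero, zero_add, hg₂, quad_zero,
        quad_smul]
      ring
    · obtain ⟨g₁, hg₁⟩ := hr _ h1
      have hA' := hA.of_double
      set q₁ := quad A (x ∘ Sum.inl) with hq₁
      set q₂ := quad A (x ∘ Sum.inr) with hq₂
      have hq₁0 : q₁ ≠ 0 := fun h => h1 (hA' _ h)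
      have hq₂0 : q₂ ≠ 0 := fun h => h2 (hA' _ h)
      set k : (ι → L) →ₗ[L] (ι → L) := q₁⁻¹ • (g₁ ∘ₗ g₂) with hk
      have hkq : ∀ v, quad A (k v) = q₂ / q₁ * quad A v := fun v => by
        rw [hk, LinearMap.smul_apply, quad_smul, LinearMap.comp_apply, hg₁, hg₂]
        field_simp
      have hkinj : Function.Injective k := (injective_iff_map_eq_zero k).2 fun v hv => by
        have := hkq v
        rw [hv, quad_zero] at this
        exact hA' v ((mul_eq_zero.1 this.symm).resolve_left (div_ne_zero hq₂0 hq₁0))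
      set e := LinearEquiv.ofInjectiveEndo k hkinj with he
      have hke : ∀ v, k (e.symm v) = v := fun v => e.apply_symm_apply v
      have hkp := pol_similar (A := A) (B := A) (g := k) (map_add k) hkq
      set k' : (ι → L) →ₗ[L] (ι → L) := -((q₂ / q₁) • e.symm.toLinearMap) with hk'
      have hk'q : ∀ v, quad A (k' v) = q₂ / q₁ * quad A v := fun v => by
        have h3 := hkq (e.symm v)
        rw [hke] at h3
        have h4 : k' v = (-(q₂ / q₁)) • e.symm v := by simp [hk']
        rw [h4, quad_smul, h3]
        field_simp
      have hkk' : ∀ u v, pol A (k' u) v = -pol A u (k v) := fun u v => by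
        have h3 := hkp (e.symm u) v
        rw [hke] at h3
        have h4 : k' u = (-(q₂ / q₁)) • e.symm u := by simp [hk']
        rw [h4, pol_smul_left, h3]
        ring
      refine ⟨blockMap g₁ 0 0 g₁ ∘ₗ blockMap LinearMap.id (α • k) k' LinearMap.id, fun y => ?_⟩
      rw [LinearMap.comp_apply, quad_double, quad_double A α x, quad_double A α y,
        blockMap_inl, blockMap_inr, blockMap_inl, blockMap_inr, ← hq₁, ← hq₂]
      simp only [LinearMap.zero_apply, LinearMap.smul_apply, add_zero, zero_add,
        LinearMap.id_apply, hg₁]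
      rw [blockMap_inr, LinearMap.id_apply, quad_add A _ (α • _), quad_add A _ (y ∘ Sum.inr),
        quad_smul, pol_smul_right, hkq, hk'q, hkk']
      field_simp
      ring

theorem PfLike.double {A : Matrix ι ι K} {c : K} (h : PfLike A c) (α : K) :
    PfLike (double A α) c := fun L _ f hf => by
  rw [double_map] at hf ⊢
  obtain ⟨hr, J, hJ⟩ := h L f hf.of_double
  refine ⟨exists_similar_double hf hr, blockMap J 0 0 J, fun v => ?_⟩
  rw [quad_double, quad_double, pol_double, blockMap_inl, blockMap_inr]
  simp only [LinearMap.zero_apply, add_zero, zero_add, hJ]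
  exact ⟨by ring, trivial⟩

end Round

section Generic

variable {K : Type} [Field K] {ι : Type} [Fintype ι]

theorem IsAniso.double_X {A : Matrix ι ι K} (hA : IsAniso A) :
    IsAniso (double (A.map (RatFunc.C : K →+* RatFunc K)) RatFunc.X) := fun u hu => by
  obtain ⟨h, f, hh, hf⟩ := exists_smul_eq_algebraMap u
  have hf' : algebraMap (Polynomial K) (RatFunc K) h • u = algebraMap _ _ ∘ f :=
    funext fun i => hf i
  have h1 : quad (double (A.map (Polynomial.C : K →+* Polynomial K)) Polynomial.X) f = 0 := by
    apply RatFunc.algebraMap_injective K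
    rw [← quad_map, ← hf', double_map, ← map_ratFuncC, RatFunc.algebraMap_X, quad_smul, hu,
      mul_zero, map_zero]
  rw [quad_double] at h1
  have h3 : f ∘ Sum.inr = 0 := by
    by_contra h3
    obtain ⟨d, -, hd0, hd⟩ := exists_natDegree_quad hA h3
    by_cases h2 : f ∘ Sum.inl = 0
    · rw [h2, quad_zero, zero_add] at h1
      exact hd0 ((mul_eq_zero.1 h1).resolve_left Polynomial.X_ne_zero)
    · obtain ⟨e, -, he0, he⟩ := exists_natDegree_quad hA h2
      have h4 := congrArg Polynomial.natDegree (eq_neg_of_add_eq_zero_left h1)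
      rw [Polynomial.natDegree_neg, Polynomial.natDegree_X_mul hd0, he, hd] at h4
      omega
  have h2 : f ∘ Sum.inl = 0 := by
    rw [h3, quad_zero, mul_zero, add_zero] at h1
    exact hA.map_C _ h1
  have h4 : f = 0 := by
    funext i
    rcases i with i | i
    exacts [congrFun h2 i, congrFun h3 i]
  funext i
  have := hf i
  rw [h4] at this
  simpa [hh] using this

theorem isAniso_binary_X : IsAniso (!![1, 1; 0, RatFunc.X] : Matrix (Fin 2) (Fin 2) (RatFunc K)) :=
  fun u hu => by
  obtain ⟨h, f, hh, hf⟩ := exists_smul_eq_algebraMap u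
  have hf' : algebraMap (Polynomial K) (RatFunc K) h • u = algebraMap _ _ ∘ f :=
    funext fun i => hf i
  have h1 : quad (!![1, 1; 0, Polynomial.X] : Matrix (Fin 2) (Fin 2) (Polynomial K)) f = 0 := by
    apply RatFunc.algebraMap_injective K
    have hm : (!![1, 1; 0, Polynomial.X] : Matrix (Fin 2) (Fin 2) (Polynomial K)).map
        (algebraMap (Polynomial K) (RatFunc K)) = !![1, 1; 0, RatFunc.X] := by
      ext i j
      fin_cases i <;> fin_cases j <;> simp
    rw [← quad_map, ← hf', hm, quad_smul, hu, mul_zero, map_zero]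
  have h1' : f 0 * (f 0 + f 1) = -(Polynomial.X * (f 1 * f 1)) := by
    simp [quad, Fin.sum_univ_two] at h1
    linear_combination h1
  have h3 : f 1 = 0 := by
    by_contra h3
    have h33 : f 1 * f 1 ≠ 0 := mul_ne_zero h3 h3
    have hne : f 0 * (f 0 + f 1) ≠ 0 := by
      rw [h1']
      exact neg_ne_zero.2 (mul_ne_zero Polynomial.X_ne_zero h33)
    have h4 := congrArg Polynomial.natDegree h1'
    rw [Polynomial.natDegree_neg, Polynomial.natDegree_X_mul h33,
      Polynomial.natDegree_mul h3 h3,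
      Polynomial.natDegree_mul (left_ne_zero_of_mul hne) (right_ne_zero_of_mul hne)] at h4
    rcases le_or_gt (f 0).natDegree (f 1).natDegree with h5 | h5
    · have := Polynomial.natDegree_add_le_of_degree_le h5 le_rfl
      omega
    · have := Polynomial.natDegree_add_eq_left_of_natDegree_lt h5
      omega
  have h2 : f 0 = 0 := by
    rw [h3] at h1'
    simpa using h1'
  funext i
  have := hf i
  fin_cases i
  · simpa [hh, h2] using this
  · simpa [hh, h3] using this

theorem ratFunc_X_ne_C (c : K) : (RatFunc.X : RatFunc K) ≠ RatFunc.C c := fun h => by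
  rw [← RatFunc.algebraMap_X, ← RatFunc.algebraMap_C] at h
  exact Polynomial.X_ne_C c (RatFunc.algebraMap_injective K h)

theorem ratFunc_sq_add_ne_C (c : K) :
    (RatFunc.X ^ 2 + RatFunc.X : RatFunc K) ≠ RatFunc.C c := fun h => by
  rw [← RatFunc.algebraMap_X, ← RatFunc.algebraMap_C, ← map_pow, ← map_add] at h
  have h1 := congrArg (fun p => p.coeff 2) (RatFunc.algebraMap_injective K h)
  simp [Polynomial.coeff_X] at h1

/-- Over a suitable field there is an anisotropic form of dimension `2ⁿ⁺¹` with the properties of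
a Pfister form whose separable slot becomes trivial in an extension keeping all forms over `F`
anisotropic. -/
theorem exists_pfLike (F : Type) [Field F] (n : ℕ) :
    ∃ (K : Type) (_ : Field K) (M : Type) (_ : Field M) (i : F →+* K) (h : K →+* M) (c : K)
      (z : M) (ι : Type) (_ : Fintype ι) (A : Matrix ι ι K), AnisoExt (h.comp i) ∧
      z ^ 2 + z = h c ∧ Fintype.card ι = 2 ^ (n + 1) ∧ PfLike A c ∧ IsAniso A := by
  induction n with
  | zero =>
    refine ⟨RatFunc F, inferInstance, RatFunc F, inferInstance, RatFunc.C,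
      ratFuncLift RatFunc.C (RatFunc.X ^ 2 + RatFunc.X) fun p hp =>
        eq_zero_of_eval₂_ratFunc (RingHom.id F) _ ratFunc_sq_add_ne_C p hp,
      RatFunc.X, RatFunc.X, Fin 2, inferInstance, !![1, 1; 0, RatFunc.X], ?_, by simp, by simp,
      PfLike.binary _, isAniso_binary_X⟩
    rw [ratFuncLift_comp_C]
    exact AnisoExt.ratFuncC
  | succ n ih =>
    obtain ⟨K, _, M, _, i, h, c, z, ι, _, A, hi, hz, hc, hA, hA'⟩ := ih
    refine ⟨RatFunc K, inferInstance, RatFunc M, inferInstance, RatFunc.C.comp i,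
      ratFuncLift (RatFunc.C.comp h) RatFunc.X fun p hp =>
        eq_zero_of_eval₂_ratFunc h _ ratFunc_X_ne_C p hp,
      RatFunc.C c, RatFunc.C z, ι ⊕ ι, inferInstance,
      double (A.map (RatFunc.C : K →+* RatFunc K)) RatFunc.X, ?_, ?_, ?_,
      (hA.map _).double _, hA'.double_X⟩
    · rw [← RingHom.comp_assoc, ratFuncLift_comp_C, RingHom.comp_assoc]
      exact AnisoExt.ratFuncC.comp hi
    · rw [ratFuncLift_C, RingHom.comp_apply, ← hz]
      simp
    · rw [Fintype.card_sum, hc, pow_succ 2 (n + 1)]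
      ring

end Generic

section Values

variable {K : Type} [Field K] {ι : Type} [Fintype ι]

/-- The values of a round anisotropic form are closed under multiplication. -/
theorem PfLike.exists_mul {A : Matrix ι ι K} {c : K} (h : PfLike A c) (hA : IsAniso A)
    (x y : ι → K) : ∃ u, quad A u = quad A x * quad A y := by
  by_cases hx : x = 0
  · exact ⟨0, by simp [hx]⟩
  · obtain ⟨hr, -⟩ := h K (RingHom.id K) (by rwa [map_ringHom_id])
    obtain ⟨g, hg⟩ := hr x hx
    rw [map_ringHom_id] at hg
    exact ⟨g y, hg y⟩

/-- The values of a round anisotropic form are closed under division. -/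
theorem PfLike.exists_div {A : Matrix ι ι K} {c : K} (h : PfLike A c) (hA : IsAniso A)
    (x y : ι → K) : ∃ u, quad A u = quad A x / quad A y := by
  obtain ⟨u, hu⟩ := h.exists_mul hA x y
  by_cases hy : quad A y = 0
  · exact ⟨0, by simp [hy]⟩
  · refine ⟨(quad A y)⁻¹ • u, ?_⟩
    rw [quad_smul, hu]
    field_simp

theorem PfLike.exists_operator {A : Matrix ι ι K} {c : K} (h : PfLike A c) (hA : IsAniso A) :
    ∃ J : (ι → K) →ₗ[K] (ι → K), ∀ v, quad A (J v) = c * quad A v ∧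
      pol A v (J v) = quad A v := by
  obtain ⟨-, J, hJ⟩ := h K (RingHom.id K) (by rwa [map_ringHom_id])
  rw [map_ringHom_id] at hJ
  exact ⟨J, hJ⟩

theorem PfLike.nondegenerate {A : Matrix ι ι K} {c : K} (h : PfLike A c) (hA : IsAniso A)
    (x : ι → K) (hx : ∀ y, pol A x y = 0) : x = 0 := by
  obtain ⟨J, hJ⟩ := h.exists_operator hA
  exact hA x (by rw [← (hJ x).2, hx])

end Values

section Orthogonal

variable {K : Type*} [Field K] {ι : Type*} [Fintype ι]

/-- The polar form of `quad A` has trivial radical. -/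
def PolNondeg (A : Matrix ι ι K) : Prop := ∀ x, (∀ y, pol A x y = 0) → x = 0

theorem PolNondeg.nondegenerate {A : Matrix ι ι K} (h : PolNondeg A) :
    (polBilin A).Nondegenerate :=
  ⟨h, fun x hx => h x fun y => by rw [pol_comm]; exact hx y⟩

theorem polBilin_isRefl (A : Matrix ι ι K) : (polBilin A).IsRefl := fun x y h => by
  rw [polBilin_apply, pol_comm]
  exact h

/-- The orthogonal complement of a family of vectors. -/
def perp (A : Matrix ι ι K) {J : Type*} (v : J → ι → K) : Submodule K (ι → K) :=
  (polBilin A).orthogonal (Submodule.span K (Set.range v))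

theorem mem_perp {A : Matrix ι ι K} {J : Type*} {v : J → ι → K} {x : ι → K} :
    x ∈ perp A v ↔ ∀ j, pol A x (v j) = 0 := by
  rw [perp, LinearMap.BilinForm.mem_orthogonal_iff]
  constructor
  · intro h j
    rw [pol_comm]
    exact h _ (Submodule.subset_span ⟨j, rfl⟩)
  · intro h y hy
    change pol A y x = 0
    induction hy using Submodule.span_induction with
    | mem y hy => obtain ⟨j, rfl⟩ := hy; rw [pol_comm, h]
    | zero => exact pol_zero_left A x
    | add y z _ _ hy hz => rw [pol_add_left, hy, hz, add_zero]
    | smul a y _ hy => rw [pol_smul_left, hy, mul_zero]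

theorem finrank_perp {A : Matrix ι ι K} (hA : PolNondeg A) {J : Type*} [Fintype J]
    {v : J → ι → K} (hv : LinearIndependent K v) :
    Module.finrank K (perp A v) = Fintype.card ι - Fintype.card J := by
  rw [perp, LinearMap.BilinForm.finrank_orthogonal hA.nondegenerate, finrank_span_eq_card hv,
    Module.finrank_fintype_fun_eq_card]

theorem mem_span_of_perp {A : Matrix ι ι K} (hA : PolNondeg A) {J : Type*}
    {v : J → ι → K} {x : ι → K} (hx : ∀ y ∈ perp A v, pol A x y = 0) :
    x ∈ Submodule.span K (Set.range v) := by
  rw [← LinearMap.BilinForm.orthogonal_orthogonal hA.nondegenerate (polBilin_isRefl A)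
    (Submodule.span K (Set.range v)), LinearMap.BilinForm.mem_orthogonal_iff]
  intro y hy
  change pol A y x = 0
  rw [pol_comm]
  exact hx y hy

theorem exists_pol_eq {A : Matrix ι ι K} (hA : PolNondeg A) {J : Type*}
    {v : J → ι → K} (hv : LinearIndependent K v) (b : J → K) :
    ∃ x, ∀ j, pol A x (v j) = b j := by
  obtain ⟨l, hl⟩ := LinearMap.exists_extend
    ((Module.Basis.span hv).constr K b)
  refine ⟨(LinearMap.BilinForm.toDual (polBilin A) hA.nondegenerate).symm l, fun j => ?_⟩
  rw [← polBilin_apply, LinearMap.BilinForm.apply_toDual_symm_apply]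
  have h1 := congrArg (fun g => g (Module.Basis.span hv j)) hl
  simp only [LinearMap.comp_apply] at h1
  rw [Module.Basis.constr_basis, Submodule.subtype_apply, Module.Basis.span_apply] at h1
  exact h1

end Orthogonal

section Matrix

variable {R : Type*} [CommRing R] {ι κ : Type*} [Fintype ι] [Fintype κ]

theorem quad_eq_dotProduct (A : Matrix ι ι R) (x : ι → R) : quad A x = x ⬝ᵥ A.mulVec x := by
  simp only [quad, dotProduct, Matrix.mulVec, Finset.mul_sum]
  refine Finset.sum_congr rfl fun i _ => Finset.sum_congr rfl fun j _ => ?_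
  ring

theorem quad_conj (A : Matrix ι ι R) (N : Matrix ι κ R) (y : κ → R) :
    quad (N.transpose * A * N) y = quad A (N.mulVec y) := by
  rw [quad_eq_dotProduct, quad_eq_dotProduct, ← Matrix.mulVec_mulVec, ← Matrix.mulVec_mulVec,
    Matrix.dotProduct_mulVec, Matrix.vecMul_transpose]

theorem quad_add_matrix (A B : Matrix ι ι R) (x : ι → R) :
    quad (A + B) x = quad A x + quad B x := by
  simp [quad, add_mul, Finset.sum_add_distrib]

theorem quad_diagonal [DecidableEq ι] (c : ι → R) (x : ι → R) :
    quad (Matrix.diagonal c) x = ∑ i, c i * x i ^ 2 := by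
  simp [quad, Matrix.diagonal_apply, pow_two, mul_assoc]

theorem pol_diagonal [DecidableEq ι] (c : ι → R) (x y : ι → R) :
    pol (Matrix.diagonal c) x y = 2 * ∑ i, c i * (x i * y i) := by
  simp [pol, Matrix.diagonal_apply, Finset.mul_sum]
  refine Finset.sum_congr rfl fun i _ => ?_
  ring

end Matrix

theorem two_eq_zero_of_map {R S : Type*} [Semiring R] [Semiring S] (f : R →+* S)
    (h : (2 : R) = 0) : (2 : S) = 0 := by
  rw [← map_ofNat f 2, h, map_zero]

section QuadraticExtension

variable {K M : Type} [Field K] [Field M]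

/-- The subfield `K + Kθ` generated by a root `θ` of a monic quadratic polynomial over `K`. -/
theorem exists_quadratic_extension (f : K →+* M) (θ : M) (b c : K)
    (hθ : θ ^ 2 = f b * θ + f c) :
    ∃ (L : Type) (_ : Field L) (i : K →+* L) (j : L →+* M) (t : L), j.comp i = f ∧ j t = θ ∧
      ∀ x : L, ∃ u v : K, x = i u + t * i v := by
  let S : Subfield M :=
    { carrier := {x | ∃ u v : K, x = f u + θ * f v}
      mul_mem' := by
        rintro _ _ ⟨u, v, rfl⟩ ⟨u', v', rfl⟩
        refine ⟨u * u' + v * v' * c, u * v' + v * u' + v * v' * b, ?_⟩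
        simp only [map_add, map_mul]
        linear_combination (f v * f v') * hθ
      one_mem' := ⟨1, 0, by simp⟩
      add_mem' := by
        rintro _ _ ⟨u, v, rfl⟩ ⟨u', v', rfl⟩
        exact ⟨u + u', v + v', by simp only [map_add]; ring⟩
      zero_mem' := ⟨0, 0, by simp⟩
      neg_mem' := by
        rintro _ ⟨u, v, rfl⟩
        exact ⟨-u, -v, by simp only [map_neg]; ring⟩
      inv_mem' := by
        rintro _ ⟨u, v, rfl⟩
        by_cases hN : u * u + u * v * b - v * v * c = 0
        · by_cases hv : v = 0
          · refine ⟨u⁻¹, 0, ?_⟩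
            simp [hv]
          · by_cases hx : f u + θ * f v = 0
            · exact ⟨0, 0, by simp [hx]⟩
            · have h1 : f u + f v * f b - θ * f v = 0 := by
                refine (mul_eq_zero.1 ?_).resolve_left hx
                have h2 := congrArg f hN
                simp only [map_add, map_sub, map_mul, map_zero] at h2
                linear_combination h2 - f v ^ 2 * hθ
              refine ⟨(u + (u + v * b))⁻¹, 0, ?_⟩
              have h3 : f u + θ * f v = f (u + (u + v * b)) := by
                simp only [map_add, map_mul]
                linear_combination -h1
              rw [h3]
              simp
        · have hN' : f (u * u + u * v * b - v * v * c) ≠ 0 := (map_ne_zero f).2 hN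
          refine ⟨(u + v * b) / (u * u + u * v * b - v * v * c),
            -v / (u * u + u * v * b - v * v * c), ?_⟩
          apply inv_eq_of_mul_eq_one_left
          rw [map_div₀, map_div₀, ← mul_div_assoc, ← add_div, div_mul_eq_mul_div,
            div_eq_one_iff_eq hN']
          simp only [map_add, map_mul, map_sub, map_neg]
          linear_combination -f v ^ 2 * hθ }
  refine ⟨S, inferInstance, f.codRestrict S.toSubring fun u => ⟨u, 0, by simp⟩, S.subtype,
    ⟨θ, 0, 1, by simp⟩, by ext; rfl, rfl, ?_⟩
  rintro ⟨x, u, v, rfl⟩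
  exact ⟨u, v, rfl⟩

/-- A totally singular form stays anisotropic over a separable quadratic extension. -/
theorem exists_artinSchreier_extension (h2 : (2 : K) = 0) (c : K)
    (hc : ∀ x : K, x ^ 2 + x ≠ c) :
    ∃ (L : Type) (_ : Field L) (f : K →+* L) (z : L), z ^ 2 + z = f c ∧
      ∀ (ι : Type) [Fintype ι] [DecidableEq ι] (d : ι → K), IsAniso (Matrix.diagonal d) →
        IsAniso ((Matrix.diagonal d).map f) := by
  obtain ⟨z, hz⟩ := IsAlgClosed.exists_root
    ((Polynomial.X ^ 2 + Polynomial.X - Polynomial.C c : Polynomial K).map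
      (algebraMap K (AlgebraicClosure K))) (by
        rw [Polynomial.degree_map]
        have : (Polynomial.X ^ 2 + Polynomial.X - Polynomial.C c : Polynomial K).degree = 2 := by
          compute_degree!
        rw [this]
        decide)
  have hz' : z ^ 2 + z = algebraMap K (AlgebraicClosure K) c := by
    simp [Polynomial.IsRoot.def] at hz
    linear_combination hz
  have h2' : (2 : AlgebraicClosure K) = 0 :=
    two_eq_zero_of_map (algebraMap K (AlgebraicClosure K)) h2
  obtain ⟨L, _, i, j, t, hji, hjt, hL⟩ := exists_quadratic_extension
    (algebraMap K (AlgebraicClosure K)) z 1 c (by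
      rw [map_one]; linear_combination hz' - z * h2')
  have ht : t ^ 2 + t = i c := j.injective (by
    rw [map_add, map_pow, hjt, hz', ← hji]; rfl)
  have h2L : (2 : L) = 0 := two_eq_zero_of_map i h2
  refine ⟨L, inferInstance, i, t, ht, fun ι _ _ d hd x hx => ?_⟩
  choose u v huv using fun k => hL (x k)
  have hx' : x = i ∘ u + t • (i ∘ v) := funext fun k => by simp [huv k]
  rw [hx', quad_add, quad_smul, pol_smul_right, quad_map, quad_map, pol_map, pol_diagonal,
    h2] at hx
  have key : i (quad (Matrix.diagonal d) u + c * quad (Matrix.diagonal d) v) +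
      t * i (quad (Matrix.diagonal d) v) = 0 := by
    simp only [map_add, map_mul, zero_mul, map_zero] at hx ⊢
    linear_combination hx - i (quad (Matrix.diagonal d) v) * ht +
      t * i (quad (Matrix.diagonal d) v) * h2L
  have hv0 : quad (Matrix.diagonal d) v = 0 := by
    by_contra hv
    set a := quad (Matrix.diagonal d) v
    set e := quad (Matrix.diagonal d) u + c * a
    have hia : i a ≠ 0 := (map_ne_zero i).2 hv
    have ht' : t = i (-e / a) := by
      rw [map_div₀, map_neg, eq_div_iff hia]
      linear_combination key
    refine hc (-e / a) (i.injective ?_)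
    rw [map_add, map_pow, ← ht', ht]
  rw [hv0, mul_zero, add_zero, map_zero, mul_zero, add_zero, map_eq_zero] at key
  rw [hx', hd _ key, hd _ hv0]
  ext; simp

end QuadraticExtension

section NotRepresented

theorem pol_eq_sub {R : Type*} [CommRing R] {ι : Type*} [Fintype ι] (A : Matrix ι ι R)
    (x y : ι → R) : pol A x y = quad A (x + y) - quad A x - quad A y := by
  rw [quad_add]; ring

theorem mulVec_of_eq_sum {R : Type*} [CommRing R] {ι κ : Type*} [Fintype κ] (col : κ → ι → R)
    (y : κ → R) : (Matrix.of fun i o => col o i).mulVec y = ∑ o, y o • col o := by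
  ext i
  simp [Matrix.mulVec, dotProduct, mul_comm]

variable {K : Type} [Field K] {ι : Type} [Fintype ι]

/-- If `s` is not a value of the affine form `∑ rⱼ vⱼ ↦ q(∑ rⱼ vⱼ) + ∑ rⱼ bⱼ`, then over some
extension in the class, `q(x) + s` is not a value of `q` for some `x` with polar values `bⱼ`
against the `vⱼ`. -/
theorem exists_not_represented (h2 : (2 : K) = 0) {A : Matrix ι ι K} (hnd : PolNondeg A)
    {J : Type} [Fintype J] {v : J → ι → K} (hv : LinearIndependent K v) (s : K) (b : J → K)
    (hni : ∀ r : J → K, quad A (∑ j, r j • v j) + ∑ j, r j * b j + s ≠ 0)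
    (P : ∀ (L : Type) [Field L], (K →+* L) → Prop)
    (hid : P K (RingHom.id K))
    (hP : ∀ (L : Type) [Field L] (f : K →+* L), P L f →
      P (RatFunc L) ((RatFunc.C : L →+* RatFunc L).comp f))
    (hA : ∀ (L : Type) [Field L] (f : K →+* L), P L f → IsAniso (A.map f)) :
    ∃ (L : Type) (_ : Field L) (f : K →+* L), P L f ∧ ∃ x : ι → L,
      (∀ j, pol (A.map f) x (f ∘ v j) = f (b j)) ∧
      ∀ u, quad (A.map f) u ≠ quad (A.map f) x + f s := by
  classical
  by_contra hcon
  push Not at hcon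
  obtain ⟨a, ha⟩ := exists_pol_eq hnd hv b
  let bs := Module.finBasis K (perp A v)
  set r := Module.finrank K (perp A v)
  let col : Option (Fin r) → ι → K := fun o => o.elim a fun l => (bs l : ι → K)
  have hcol : ∀ l j, pol A (col (some l)) (v j) = 0 := fun l j => mem_perp.1 (bs l).2 j
  let N : Matrix ι (Option (Fin r)) K := Matrix.of fun i o => col o i
  let B : Matrix (Option (Fin r)) (Option (Fin r)) K :=
    N.transpose * A * N + Matrix.diagonal (Pi.single none s)
  have hB : ∀ {L : Type} [Field L] (f : K →+* L) (y : Option (Fin r) → L),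
      quad (B.map f) y = quad (A.map f) (∑ o, y o • (f ∘ col o)) + f s * y none ^ 2 := by
    intro L _ f y
    have h1 : B.map f = (N.map f).transpose * A.map f * N.map f +
        Matrix.diagonal (Pi.single none (f s)) := by
      simp only [B, Matrix.map_add _ (map_add f), Matrix.map_mul, Matrix.transpose_map]
      congr 1
      rw [Matrix.diagonal_map (map_zero f)]
      congr 1
      ext o
      exact (Pi.apply_single (fun _ => f) (fun _ => map_zero f) none s o)
    rw [h1, quad_add_matrix, quad_conj, quad_diagonal]
    congr 1
    · exact congrArg _ (mulVec_of_eq_sum (fun o => f ∘ col o) y)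
    · rw [Finset.sum_eq_single none] <;> simp +contextual
  have hBK : ∀ y, quad B y = quad A (∑ o, y o • col o) + s * y none ^ 2 := fun y => by
    have h := hB (RingHom.id K) y
    rw [map_ringHom_id, map_ringHom_id] at h
    exact h
  have hrep : ∀ (L : Type) [Field L] (f : K →+* L), P L f → ∀ y : Option (Fin r) → L,
      ∃ u, quad (A.map f) u = quad (B.map f) y := by
    intro L _ f hf y
    rw [hB]
    set x := ∑ o, y o • (f ∘ col o) with hx
    by_cases ht : y none = 0
    · exact ⟨x, by rw [ht]; ring⟩
    · have hxj : ∀ j, pol (A.map f) x (f ∘ v j) = y none * f (b j) := fun j => by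
        rw [hx, pol_sum_left, Fintype.sum_option, pol_smul_left, pol_map]
        change y none * f (pol A a (v j)) + _ = _
        rw [ha, Finset.sum_eq_zero, add_zero]
        intro l _
        rw [pol_smul_left, pol_map, hcol, map_zero, mul_zero]
      obtain ⟨u, hu⟩ := hcon L inferInstance f hf ((y none)⁻¹ • x) (fun j => by
        rw [pol_smul_left, hxj, inv_mul_cancel_left₀ ht])
      refine ⟨y none • u, ?_⟩
      rw [quad_smul, hu, quad_smul]
      field_simp
  have hsum : ∀ o, ∑ o', (Pi.single o (1 : K) : Option (Fin r) → K) o' • col o' = col o :=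
    fun o => by
      rw [Finset.sum_eq_single o] <;> simp +contextual
  have hBp : ∀ o o', pol B (Pi.single o 1) (Pi.single o' 1) = pol A (col o) (col o') := by
    intro o o'
    rw [pol_eq_sub, hBK, hBK, hBK, pol_eq_sub]
    simp only [Pi.add_apply, add_smul, Finset.sum_add_distrib, hsum]
    linear_combination
      s * (Pi.single o (1 : K) : Option (Fin r) → K) none *
        (Pi.single o' (1 : K) : Option (Fin r) → K) none * h2
  have hBq : ∀ l : Fin r, quad B (Pi.single (some l) 1) = quad A (col (some l)) := fun l => by
    rw [hBK, hsum]; simp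
  let S : List ((Option (Fin r) → K) × (ι → K)) :=
    (List.finRange r).map fun l => (Pi.single (some l) 1, col (some l))
  have hSq : ∀ p ∈ S, quad A p.2 = quad B p.1 := by
    intro p hp
    obtain ⟨l, -, rfl⟩ := List.mem_map.1 hp
    exact (hBq l).symm
  have hSp : ∀ p ∈ S, ∀ p' ∈ S, pol A p.2 p'.2 = pol B p.1 p'.1 := by
    intro p hp p' hp'
    obtain ⟨l, -, rfl⟩ := List.mem_map.1 hp
    obtain ⟨l', -, rfl⟩ := List.mem_map.1 hp'
    exact (hBp (some l) (some l')).symm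
  obtain ⟨u, hu, hup⟩ := exists_quad_eq_of_represents P hP hA hrep S hSq hSp K
    (RingHom.id K) hid (Pi.single none 1)
  rw [map_ringHom_id, map_ringHom_id, hBK, hsum] at hu
  have hup' : ∀ l : Fin r, pol A u (col (some l)) = pol A a (col (some l)) := fun l => by
    have h := hup (Pi.single (some l) 1, col (some l)) (List.mem_map.2 ⟨l, by simp, rfl⟩)
    rw [map_ringHom_id, map_ringHom_id] at h
    exact h.trans (hBp none (some l))
  have hspan : u - a ∈ Submodule.span K (Set.range v) := by
    refine mem_span_of_perp hnd fun y hy => ?_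
    have hy' : y = ∑ l, bs.repr ⟨y, hy⟩ l • col (some l) := by
      have h := congrArg (perp A v).subtype (bs.sum_repr ⟨y, hy⟩)
      rw [map_sum] at h
      exact h.symm
    rw [hy', pol_sum_right]
    refine Finset.sum_eq_zero fun l _ => ?_
    rw [pol_smul_right, pol_sub_left, hup', sub_self, mul_zero]
  obtain ⟨ρ, hρ⟩ := (Submodule.mem_span_range_iff_exists_fun K).1 hspan
  have hu' : u = a + ∑ j, ρ j • v j := by rw [hρ]; abel
  have hpa : pol A a (∑ j, ρ j • v j) = ∑ j, ρ j * b j := by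
    rw [pol_sum_right]
    exact Finset.sum_congr rfl fun j _ => by rw [pol_smul_right, ha]
  refine hni ρ ?_
  rw [hu', quad_add, hpa] at hu
  have hc : col none = a := rfl
  simp only [hc, Pi.single_eq_same] at hu
  linear_combination hu + s * h2

end NotRepresented

section Stage

theorem generic_not_represented {L : Type*} [Field L] {ι : Type*} [Fintype ι] {A : Matrix ι ι L}
    (hA : IsAniso A) (c₀ c₁ c₂ : L) (Y : L) (h : ∀ u, quad A u ≠ c₀ + c₁ * Y + c₂ * Y ^ 2)
    (u : ι → RatFunc L) : quad (A.map (RatFunc.C : L →+* RatFunc L)) u ≠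
      RatFunc.C c₀ + RatFunc.C c₁ * RatFunc.X + RatFunc.C c₂ * RatFunc.X ^ 2 := fun hu => by
  obtain ⟨u₀, u₁, h0, h01, h1, -⟩ := cassels_pfister hA (J := Empty) (fun j => j.elim) c₀ c₁ c₂
    (fun j => j.elim) (fun j => j.elim) u hu (fun j => j.elim)
  refine h (u₀ + Y • u₁) ?_
  rw [quad_add, quad_smul, pol_smul_right, h0, h01, h1]
  ring

theorem IsAniso.map_quadratic {E : Type} [Field E] (h2 : (2 : E) = 0) {ι : Type} [Fintype ι]
    {A : Matrix ι ι E} {c : E} (hA : IsAniso A) (hPf : PfLike A c) {L : Type} [Field L]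
    (i : E →+* L) (t : L) (y d : E) (ht : t ^ 2 = i y * t + i d)
    (hL : ∀ x : L, ∃ u v : E, x = i u + t * i v) (w : ι → E) (X : E)
    (hn : ∀ u, quad A u ≠ quad A w * (X ^ 2 + X * y + d)) : IsAniso (A.map i) := fun x hx => by
  choose u v huv using fun k => hL (x k)
  have hx' : x = i ∘ u + t • (i ∘ v) := funext fun k => by simp [huv k]
  have hx0 := hx
  rw [hx', quad_add, quad_smul, pol_smul_right, quad_map, quad_map, pol_map] at hx
  have key : i (quad A u + d * quad A v) + t * i (pol A u v + y * quad A v) = 0 := by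
    simp only [map_add, map_mul] at hx ⊢
    linear_combination hx - i (quad A v) * ht
  by_cases ha : pol A u v + y * quad A v = 0
  · rw [ha, map_zero, mul_zero, add_zero, map_eq_zero] at key
    by_cases hv : v = 0
    · rw [hv, quad_zero, mul_zero, add_zero] at key
      rw [hx', hv, hA u key]
      ext; simp
    · have hq : quad A v ≠ 0 := fun h => hv (hA v h)
      obtain ⟨u', hu'⟩ := hPf.exists_div hA (u + X • v) v
      obtain ⟨u'', hu''⟩ := hPf.exists_mul hA w u'
      refine absurd ?_ (hn u'')
      rw [hu'', hu', quad_add, quad_smul, pol_smul_right]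
      congr 1
      rw [div_eq_iff hq]
      linear_combination key + X * ha - (d * quad A v + X * y * quad A v) * h2
  · have hia : i (pol A u v + y * quad A v) ≠ 0 := (map_ne_zero i).2 ha
    have ht' : t = i (-(quad A u + d * quad A v) / (pol A u v + y * quad A v)) := by
      rw [map_div₀, map_neg, eq_div_iff hia]
      linear_combination key
    have hx'' : x = i ∘ (u + (-(quad A u + d * quad A v) / (pol A u v + y * quad A v)) • v) := by
      rw [hx', ht']
      ext k
      simp
    rw [hx'', quad_map, map_eq_zero] at hx0
    rw [hx'', hA _ hx0]
    ext; simp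

theorem ratFunc_X_add_div_ne_C {M : Type*} [Field M] (b e : M) :
    (RatFunc.X + RatFunc.C b / RatFunc.X : RatFunc M) ≠ RatFunc.C e := fun h => by
  have h1 : (RatFunc.X : RatFunc M) * RatFunc.X + RatFunc.C b = RatFunc.C e * RatFunc.X := by
    rw [← h, add_mul, div_mul_cancel₀ _ RatFunc.X_ne_zero]
  rw [← RatFunc.algebraMap_X, ← RatFunc.algebraMap_C, ← RatFunc.algebraMap_C, ← map_mul,
    ← map_mul, ← map_add] at h1
  have h2 := congrArg (fun p => p.coeff 2) (RatFunc.algebraMap_injective M h1)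
  simp [Polynomial.coeff_X] at h2

/-- Decomposition of a vector along the plane spanned by `w` and `w'`. -/
theorem exists_plane_decomposition {L : Type*} [Field L] (h2 : (2 : L) = 0) {ι : Type*}
    [Fintype ι] (A : Matrix ι ι L) {w w' : ι → L} (hw : quad A w ≠ 0)
    (hww : pol A w w' = quad A w) (x : ι → L) :
    ∃ (X Y : L) (x' : ι → L), x = x' + X • w + Y • w' ∧ pol A x' w = 0 ∧ pol A x' w' = 0 := by
  have h3 : pol A w' w = quad A w := by rw [pol_comm, hww]
  refine ⟨pol A x w' / quad A w, pol A x w / quad A w,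
    x - (pol A x w' / quad A w) • w - (pol A x w / quad A w) • w', by abel, ?_, ?_⟩
  · rw [pol_sub_left, pol_sub_left, pol_smul_left, pol_smul_left, h3, pol_self, h2,
      div_mul_cancel₀ _ hw]
    ring
  · rw [pol_sub_left, pol_sub_left, pol_smul_left, pol_smul_left, hww, pol_self, h2,
      div_mul_cancel₀ _ hw]
    ring

theorem quad_plane {R : Type*} [CommRing R] {ι : Type*} [Fintype ι] (A : Matrix ι ι R)
    {w w' x : ι → R} {a c : R} (hw : quad A w = a) (hww : pol A w w' = a)
    (hw' : quad A w' = c * a) (h1 : pol A x w = 0) (h1' : pol A x w' = 0) (X Y : R) :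
    quad A (x + X • w + Y • w') = quad A x + a * (X ^ 2 + X * Y + c * Y ^ 2) := by
  rw [quad_add, quad_add, quad_smul, quad_smul, pol_add_left, pol_smul_right, pol_smul_right,
    pol_smul_right, pol_smul_left, hw, hw', h1, h1', hww]
  ring

theorem sq_eq_of_artinSchreier {R : Type*} [CommRing R] (h2 : (2 : R) = 0) {T e y c b : R}
    (he : e ^ 2 + e = c) (hy : y * T = T ^ 2 + b) :
    (T + e * y) ^ 2 = y * (T + e * y) + (c * y ^ 2 + b) := by
  linear_combination (T * e * y - e * y ^ 2 - b) * h2 + y ^ 2 * he - hy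

variable {K M : Type} [Field K] [Field M] {ι : Type} [Fintype ι]

/-- The extension in which one more vector with prescribed value and polar values appears. -/
theorem exists_stage (h2 : (2 : K) = 0) {A : Matrix ι ι K} {c₀ c : K} (hA : IsAniso A)
    (hPf : PfLike A c₀) (h : K →+* M) (z : M) (hz : z ^ 2 + z = h c) {w w' : ι → K}
    (hw : quad A w ≠ 0) (hww : pol A w w' = quad A w) (hw' : quad A w' = c * quad A w)
    {J : Type} [Fintype J] {v : J → ι → K} (hv : LinearIndependent K v)
    (hvw : ∀ j, pol A w (v j) = 0) (hvw' : ∀ j, pol A w' (v j) = 0) (s : K) (b : J → K)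
    (hni : ∀ r : J → K, quad A (∑ j, r j • v j) + ∑ j, r j * b j + s ≠ 0) :
    ∃ (K' : Type) (_ : Field K') (M' : Type) (_ : Field M') (i : K →+* K') (k : M →+* M')
      (h' : K' →+* M'), AnisoExt k ∧ h'.comp i = k.comp h ∧ IsAniso (A.map i) ∧
      ∃ x : ι → K', quad (A.map i) x = i s ∧ ∀ j, pol (A.map i) x (i ∘ v j) = i (b j) := by
  obtain ⟨L, _, f, ⟨hf, ML, _, k, g, hk, hgk⟩, x, hxv, hx⟩ :=
    exists_not_represented h2 (hPf.nondegenerate hA) hv s b hni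
      (fun L _ f => AnisoExt f ∧ ∃ (ML : Type) (_ : Field ML) (k : M →+* ML) (g : L →+* ML),
        AnisoExt k ∧ g.comp f = k.comp h)
      ⟨AnisoExt.id, M, inferInstance, RingHom.id M, h, AnisoExt.id, rfl⟩
      (fun L _ f ⟨hf, ML, _, k, g, hk, hgk⟩ => ⟨AnisoExt.ratFuncC.comp hf, RatFunc ML,
        inferInstance, RatFunc.C.comp k, ratFuncLift (RatFunc.C.comp g) RatFunc.X
          (fun p hp => eq_zero_of_eval₂_ratFunc g _ ratFunc_X_ne_C p hp),
        AnisoExt.ratFuncC.comp hk, by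
          rw [← RingHom.comp_assoc, ratFuncLift_comp_C, RingHom.comp_assoc, hgk,
            RingHom.comp_assoc]⟩)
      (fun L _ f hf => hf.1 _ _ hA)
  have h2L : (2 : L) = 0 := two_eq_zero_of_map f h2
  have hAL : IsAniso (A.map f) := hf _ _ hA
  have hwL : quad (A.map f) (f ∘ w) ≠ 0 := by rw [quad_map]; exact (map_ne_zero f).2 hw
  have hwwL : pol (A.map f) (f ∘ w) (f ∘ w') = quad (A.map f) (f ∘ w) := by
    rw [pol_map, hww, quad_map]
  have hw'L : quad (A.map f) (f ∘ w') = f c * quad (A.map f) (f ∘ w) := by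
    rw [quad_map, hw', quad_map, map_mul]
  obtain ⟨X, Y, x', hx', h1, h1'⟩ := exists_plane_decomposition h2L (A.map f) hwL hwwL x
  set a := quad (A.map f) (f ∘ w) with ha
  set β := quad (A.map f) x' + f s with hβ
  have hx'v : ∀ j, pol (A.map f) x' (f ∘ v j) = f (b j) := fun j => by
    have := hxv j
    rw [hx', pol_add_left, pol_add_left, pol_smul_left, pol_smul_left, pol_map, pol_map, hvw,
      hvw'] at this
    simpa using this
  have hn : ∀ u, quad (A.map f) u ≠ (β + a * X ^ 2) + (a * X) * Y + (a * f c) * Y ^ 2 := by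
    intro u hu
    refine hx u (hu.trans ?_)
    rw [hx', quad_plane (A.map f) ha.symm hwwL hw'L h1 h1', hβ]
    ring
  have hnE := generic_not_represented hAL _ _ _ Y hn
  set AE := (A.map f).map (RatFunc.C : L →+* RatFunc L) with hAE
  have hτ := fun p hp => eq_zero_of_eval₂_ratFunc (K := L) g _
    (ratFunc_X_add_div_ne_C (g (β / a))) p hp
  set τ := ratFuncLift (RatFunc.C.comp g) (RatFunc.X + RatFunc.C (g (β / a)) / RatFunc.X) hτ
    with hτ'
  have h2M : (2 : RatFunc ML) = 0 := two_eq_zero_of_map τ (two_eq_zero_of_map RatFunc.C h2L)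
  have hzc : (RatFunc.C (k z)) ^ 2 + RatFunc.C (k z) = RatFunc.C (g (f c)) := by
    have h3 : g (f c) = k (h c) := RingHom.congr_fun hgk c
    rw [h3, ← hz, ← map_pow, ← map_add, map_add k, map_pow k]
  set d : RatFunc L := RatFunc.C (f c) * RatFunc.X ^ 2 + RatFunc.C (β / a) with hd
  set y : RatFunc ML := RatFunc.X + RatFunc.C (g (β / a)) / RatFunc.X with hy
  have hyX : y * RatFunc.X = RatFunc.X ^ 2 + RatFunc.C (g (β / a)) := by
    rw [hy, add_mul, div_mul_cancel₀ _ RatFunc.X_ne_zero, pow_two]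
  have hτX : τ RatFunc.X = y := ratFuncLift_X _ _ _
  have hτd : τ d = RatFunc.C (g (f c)) * y ^ 2 + RatFunc.C (g (β / a)) := by
    rw [hd, map_add, map_mul, map_pow, hτX, hτ', ratFuncLift_C, ratFuncLift_C]
    rfl
  obtain ⟨K', _, i, h', t, hi, ht, hK'⟩ := exists_quadratic_extension τ
    (RatFunc.X + RatFunc.C (k z) * y) RatFunc.X d (by
      rw [hτX, hτd]
      exact sq_eq_of_artinSchreier h2M hzc hyX)
  have hhi : ∀ u, h' (i u) = τ u := RingHom.congr_fun hi
  have ht2 : t ^ 2 = i RatFunc.X * t + i d := h'.injective (by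
    rw [map_add, map_mul, map_pow, ht, hhi, hhi, hτX, hτd]
    exact sq_eq_of_artinSchreier h2M hzc hyX)
  refine ⟨K', inferInstance, RatFunc ML, inferInstance, i.comp (RatFunc.C.comp f),
    RatFunc.C.comp k, h', AnisoExt.ratFuncC.comp hk, ?_, ?_,
    i ∘ (RatFunc.C ∘ x') + t • (i ∘ (RatFunc.C ∘ (f ∘ w))) +
      i RatFunc.X • (i ∘ (RatFunc.C ∘ (f ∘ w'))), ?_, ?_⟩
  · rw [← RingHom.comp_assoc, hi, ← RingHom.comp_assoc, hτ', ratFuncLift_comp_C,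
      RingHom.comp_assoc, hgk, RingHom.comp_assoc]
  · rw [map_map_ringHom, map_map_ringHom]
    refine IsAniso.map_quadratic (two_eq_zero_of_map RatFunc.C h2L) hAL.map_ratFunc
      ((hPf.map f).map RatFunc.C) i t RatFunc.X d ht2 hK' (RatFunc.C ∘ (f ∘ w))
      (RatFunc.C X) fun u hu => hnE u ?_
    rw [hu, quad_map, ← ha, hd, map_div₀]
    have haC : (RatFunc.C a : RatFunc L) ≠ 0 := (map_ne_zero _).2 hwL
    simp only [map_add, map_mul, map_pow]
    field_simp
    ring
  · have hval : i (RatFunc.C a) * i d =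
        i (RatFunc.C a) * (i (RatFunc.C (f c)) * i RatFunc.X ^ 2) + i (RatFunc.C β) := by
      rw [← map_pow, ← map_mul, ← map_mul, ← map_mul, ← map_add, hd, mul_add, ← map_mul _ a (β / a),
        mul_div_cancel₀ _ hwL]
    have h2K' : (2 : K') = 0 := two_eq_zero_of_map i (two_eq_zero_of_map RatFunc.C h2L)
    change quad (A.map ((i.comp RatFunc.C).comp f)) ((i.comp RatFunc.C) ∘ x' +
      t • ((i.comp RatFunc.C) ∘ (f ∘ w)) + i RatFunc.X • ((i.comp RatFunc.C) ∘ (f ∘ w'))) = _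
    rw [map_map_ringHom, quad_plane (a := i (RatFunc.C a)) (c := i (RatFunc.C (f c)))]
    · rw [quad_map]
      have hs : i (RatFunc.C (f s)) =
          i (RatFunc.C β) - i (RatFunc.C (quad (A.map f) x')) := by
        rw [hβ, map_add, map_add]; ring
      simp only [RingHom.comp_apply]
      rw [hs]
      linear_combination i (RatFunc.C a) * ht2 + hval + (i (RatFunc.C a) * (i RatFunc.X * t +
        i (RatFunc.C (f c)) * i RatFunc.X ^ 2) + i (RatFunc.C (quad (A.map f) x'))) * h2K'
    · rw [quad_map]; rfl
    · rw [pol_map, hwwL]; rfl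
    · rw [quad_map, hw'L, map_mul]; rfl
    · rw [pol_map, h1, map_zero]
    · rw [pol_map, h1', map_zero]
  · intro j
    change pol (A.map ((i.comp RatFunc.C).comp f)) ((i.comp RatFunc.C) ∘ x' +
      t • ((i.comp RatFunc.C) ∘ (f ∘ w)) + i RatFunc.X • ((i.comp RatFunc.C) ∘ (f ∘ w')))
        ((i.comp RatFunc.C) ∘ (f ∘ v j)) = (i.comp RatFunc.C) (f (b j))
    rw [map_map_ringHom, pol_add_left, pol_add_left, pol_smul_left, pol_smul_left, pol_map,
      pol_map, pol_map, pol_map, pol_map, hvw, hvw', hx'v]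
    simp

end Stage

section GramOn

theorem comp_single_one {R T : Type*} {J : Type*} [DecidableEq J] [Semiring R]
    [Semiring T] (f : R →+* T) (j : J) :
    f ∘ (Pi.single j 1 : J → R) = Pi.single j 1 := by
  ext k
  simp [Pi.single_apply, apply_ite f]

theorem sum_single_apply {R : Type*} [CommRing R] {J : Type*} [DecidableEq J]
    {S : Finset J} (r : S → R) (k : J) :
    (∑ j, r j • (Pi.single (j : J) 1 : J → R)) k = if hk : k ∈ S then r ⟨k, hk⟩ else 0 := by
  rw [Finset.sum_apply]
  split_ifs with hk
  · rw [Finset.sum_eq_single ⟨k, hk⟩]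
    · simp
    · intro j _ hj
      have : k ≠ j := fun h => hj (Subtype.ext h.symm)
      simp [this]
    · simp
  · refine Finset.sum_eq_zero fun j _ => ?_
    have : k ≠ j := fun h => hk (h ▸ j.2)
    simp [this]

/-- The vectors `v j`, for `j ∈ S`, span a copy of the restriction of the form `B`. -/
def GramOn {R : Type*} [CommRing R] {ι J : Type*} [Fintype ι] [Fintype J] [DecidableEq J]
    (A : Matrix ι ι R) (B : Matrix J J R) (S : Finset J) (v : J → ι → R) : Prop :=
  (∀ j ∈ S, quad A (v j) = quad B (Pi.single j 1)) ∧
    ∀ j ∈ S, ∀ k ∈ S, pol A (v j) (v k) = pol B (Pi.single j 1) (Pi.single k 1)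

variable {R : Type*} [CommRing R] {ι J : Type*} [Fintype ι] [Fintype J] [DecidableEq J]
  {A : Matrix ι ι R} {B : Matrix J J R} {S : Finset J} {v : J → ι → R}

theorem GramOn.map (h : GramOn A B S v) {T : Type*} [CommRing T] (f : R →+* T) :
    GramOn (A.map f) (B.map f) S fun j => f ∘ v j := by
  refine ⟨fun j hj => ?_, fun j hj k hk => ?_⟩
  · rw [quad_map, h.1 j hj, ← comp_single_one f, quad_map]
  · rw [pol_map, h.2 j hj k hk, ← comp_single_one f, ← comp_single_one f, pol_map]

theorem GramOn.quad_sum (h : GramOn A B S v) (r : S → R) :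
    quad A (∑ j, r j • v j) = quad B (∑ j, r j • Pi.single (j : J) 1) :=
  quad_sum_congr (κ := S) (v := fun j => v j) (w := fun j => Pi.single (j : J) 1)
    (fun j _ => h.1 j j.2) (fun j _ k _ => h.2 j j.2 k k.2) r

theorem GramOn.quad_sum_univ (h : GramOn A B Finset.univ v) (r : J → R) :
    quad A (∑ j, r j • v j) = quad B r := by
  rw [quad_sum_congr h.1 h.2 r, ← pi_eq_sum_univ' r]

theorem GramOn.pol_sum_univ (h : GramOn A B Finset.univ v) (r t : J → R) :
    pol A (∑ j, r j • v j) (∑ j, t j • v j) = pol B r t := by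
  rw [pol_eq_sub, pol_eq_sub, ← Finset.sum_add_distrib, ← h.quad_sum_univ, ← h.quad_sum_univ,
    ← h.quad_sum_univ]
  simp only [Pi.add_apply, add_smul]

theorem GramOn.linearIndependent (h : GramOn A B S v) (hB : IsAniso B) :
    LinearIndependent R fun j : S => v j := by
  rw [Fintype.linearIndependent_iff]
  intro r hr j
  have h1 := hB _ (by rw [← h.quad_sum, hr, quad_zero])
  have h2 := congrFun h1 j
  rw [sum_single_apply, dif_pos j.2] at h2
  exact h2

theorem GramOn.insert (h : GramOn A B S v) {l : J} (hl : l ∉ S) {x : ι → R}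
    (hx : quad A x = quad B (Pi.single l 1))
    (hxv : ∀ j ∈ S, pol A x (v j) = pol B (Pi.single l 1) (Pi.single j 1)) :
    GramOn A B (insert l S) (Function.update v l x) := by
  have hne : ∀ j ∈ S, Function.update v l x j = v j := fun j hj =>
    Function.update_of_ne (ne_of_mem_of_not_mem hj hl) _ _
  have hself := Function.update_self l x v
  refine ⟨fun j hj => ?_, fun j hj k hk => ?_⟩
  · rcases Finset.mem_insert.1 hj with hj | hj
    · rw [hj, hself, hx]
    · rw [hne j hj, h.1 j hj]
  · rcases Finset.mem_insert.1 hj with hj | hj <;> rcases Finset.mem_insert.1 hk with hk | hk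
    · rw [hj, hk, hself, pol_self, pol_self, hx]
    · rw [hj, hself, hne k hk, hxv k hk]
    · rw [hk, hself, hne j hj, pol_comm, hxv j hj, pol_comm]
    · rw [hne j hj, hne k hk, h.2 j hj k hk]

end GramOn

section Construction

variable {K M : Type} [Field K] [Field M] {ι J : Type} [Fintype ι] [Fintype J] [DecidableEq J]

theorem exists_gramOn_insert (h2 : (2 : K) = 0) {A : Matrix ι ι K} {c₀ c : K} (hA : IsAniso A)
    (hPf : PfLike A c₀) (h : K →+* M) (z : M) (hz : z ^ 2 + z = h c) {w w' : ι → K}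
    (hw : quad A w ≠ 0) (hww : pol A w w' = quad A w) (hw' : quad A w' = c * quad A w)
    {B : Matrix J J K} (hB : IsAniso B) {S : Finset J} {v : J → ι → K} (hv : GramOn A B S v)
    {l : J} (hl : l ∉ S) (hvw : ∀ j ∈ S, pol A w (v j) = 0) (hvw' : ∀ j ∈ S, pol A w' (v j) = 0) :
    ∃ (K' : Type) (_ : Field K') (M' : Type) (_ : Field M') (i : K →+* K') (k : M →+* M')
      (h' : K' →+* M'), AnisoExt k ∧ h'.comp i = k.comp h ∧ IsAniso (A.map i) ∧
      ∃ v' : J → ι → K', GramOn (A.map i) (B.map i) (insert l S) v' := by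
  obtain ⟨K', _, M', _, i, k, h', hk, hi, hA', x, hx, hxv⟩ := exists_stage h2 hA hPf h z hz hw hww
    hw' (hv.linearIndependent hB) (fun j => hvw j j.2) (fun j => hvw' j j.2)
    (quad B (Pi.single l 1)) (fun j => pol B (Pi.single l 1) (Pi.single (j : J) 1)) (by
      intro r hr
      have h1 := hB (∑ j, r j • (Pi.single (j : J) 1 : J → K) + Pi.single l 1) (by
        rw [quad_add, ← hv.quad_sum, pol_comm, pol_sum_right, ← hr]
        simp only [pol_smul_right]
        ring)
      have h3 := congrFun h1 l
      rw [Pi.add_apply, sum_single_apply, dif_neg hl] at h3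
      simp at h3)
  refine ⟨K', inferInstance, M', inferInstance, i, k, h', hk, hi, hA', _,
    (hv.map i).insert hl (x := x) ?_ fun j hj => ?_⟩
  · rw [hx, ← comp_single_one i, quad_map]
  · rw [hxv ⟨j, hj⟩, ← comp_single_one i, ← comp_single_one i, pol_map]

theorem exists_gramOn {F : Type} [Field F] (h2 : (2 : F) = 0) {B : Matrix J J F}
    (hB : IsAniso B) (n : ℕ) (S : Finset J) (hS : S.card ≤ 2 ^ n) :
    ∃ (K : Type) (_ : Field K) (M : Type) (_ : Field M) (i : F →+* K) (h : K →+* M) (c : K)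
      (z : M) (ι : Type) (_ : Fintype ι) (A : Matrix ι ι K), AnisoExt (h.comp i) ∧
      z ^ 2 + z = h c ∧ Fintype.card ι = 2 ^ (n + 1) ∧ PfLike A c ∧ IsAniso A ∧
      ∃ v : J → ι → K, GramOn A (B.map i) S v := by
  induction S using Finset.induction_on with
  | empty =>
    obtain ⟨K, _, M, _, i, h, c, z, ι, _, A, hi, hz, hc, hA, hA'⟩ := exists_pfLike F n
    exact ⟨K, inferInstance, M, inferInstance, i, h, c, z, ι, inferInstance, A, hi, hz, hc, hA,
      hA', 0, by simp [GramOn]⟩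
  | insert l S hl ih =>
    rw [Finset.card_insert_of_notMem hl] at hS
    obtain ⟨K, _, M, _, i, h, c, z, ι, _, A, hi, hz, hc, hPf, hA, v, hv⟩ := ih (by omega)
    have hBK : IsAniso (B.map i) := IsAniso.of_map h (by
      rw [← map_map_ringHom]
      exact hi _ _ hB)
    obtain ⟨D, hD⟩ := hPf.exists_operator hA
    obtain ⟨w, hw, hw0⟩ := (Submodule.ne_bot_iff _).1 (LinearMap.ker_ne_bot_of_finrank_lt
      (f := (LinearMap.pi fun j : S ⊕ S => Sum.elim (fun j : S => (polBilin A).flip (v j))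
        (fun j : S => (polBilin A).flip (v j) ∘ₗ D) j : (ι → K) →ₗ[K] (S ⊕ S → K))) (by
          rw [Module.finrank_fintype_fun_eq_card, Module.finrank_fintype_fun_eq_card, hc,
            Fintype.card_sum, Fintype.card_coe, pow_succ]
          omega))
    have hker := congrFun (LinearMap.mem_ker.1 hw)
    obtain ⟨K', _, M', _, i', k, h', hk, hi', hA', v', hv'⟩ := exists_gramOn_insert
      (two_eq_zero_of_map i h2) hA hPf h z hz (w := w) (w' := D w) (fun h => hw0 (hA w h))
      (hD w).2 (hD w).1 hBK hv hl (fun j hj => hker (Sum.inl ⟨j, hj⟩))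
      (fun j hj => hker (Sum.inr ⟨j, hj⟩))
    refine ⟨K', inferInstance, M', inferInstance, i'.comp i, h', i' c, k z, ι, inferInstance,
      A.map i', ?_, ?_, hc, hPf.map i', hA', v', ?_⟩
    · rw [← RingHom.comp_assoc, hi', RingHom.comp_assoc]
      exact hk.comp hi
    · rw [← RingHom.comp_apply h', hi', RingHom.comp_apply, ← hz, map_add, map_pow]
    · rwa [map_map_ringHom]

theorem exists_perp_pair {A : Matrix ι ι K} (hnd : PolNondeg A) {T : Type} [Fintype T]
    {v : T → ι → K} (hv : LinearIndependent K v)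
    (hcard : Fintype.card ι = Fintype.card T + Fintype.card T) {p q : T}
    (hpq : pol A (v p) (v q) ≠ 0) :
    ∃ w w', (∀ j, pol A w (v j) = 0) ∧ (∀ j, pol A w' (v j) = 0) ∧ pol A w w' ≠ 0 := by
  by_contra! hcon
  have hle : perp A v ≤ Submodule.span K (Set.range v) := fun x hx =>
    mem_span_of_perp hnd fun y hy => hcon x y (mem_perp.1 hx) (mem_perp.1 hy)
  have heq := Submodule.eq_of_le_of_finrank_eq hle (by
    rw [finrank_perp hnd hv, finrank_span_eq_card hv, hcard, Nat.add_sub_cancel])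
  refine hpq (mem_perp.1 (?_ : v p ∈ perp A v) q)
  rw [heq]
  exact Submodule.subset_span ⟨p, rfl⟩

theorem exists_gramOn_univ {F : Type} [Field F] (h2 : (2 : F) = 0) {B : Matrix J J F}
    (hB : IsAniso B) (n : ℕ) (hJ : Fintype.card J = 2 ^ n + 1) {p q l : J} (hp : p ≠ l)
    (hq : q ≠ l) (hpq : pol B (Pi.single p 1) (Pi.single q 1) ≠ 0) :
    ∃ (K : Type) (_ : Field K) (i : F →+* K) (c : K) (ι : Type) (_ : Fintype ι)
      (A : Matrix ι ι K), (∀ (T : Type) [Fintype T] [DecidableEq T] (d : T → F),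
        IsAniso (Matrix.diagonal d) → IsAniso ((Matrix.diagonal d).map i)) ∧
      Fintype.card ι = 2 ^ (n + 1) ∧ PfLike A c ∧ IsAniso A ∧
      ∃ v : J → ι → K, GramOn A (B.map i) Finset.univ v := by
  have hcS : (Finset.univ.erase l).card = 2 ^ n := by
    rw [Finset.card_erase_of_mem (Finset.mem_univ l), Finset.card_univ, hJ, Nat.add_sub_cancel]
  obtain ⟨K, _, M, _, i, h, c, z, ι, _, A, hi, hz, hc, hPf, hA, v, hv⟩ :=
    exists_gramOn h2 hB n (Finset.univ.erase l) hcS.le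
  have h2K : (2 : K) = 0 := two_eq_zero_of_map i h2
  have hBK : IsAniso (B.map i) := IsAniso.of_map h (by
    rw [← map_map_ringHom]
    exact hi _ _ hB)
  have hpS : p ∈ Finset.univ.erase l := Finset.mem_erase.2 ⟨hp, Finset.mem_univ p⟩
  have hqS : q ∈ Finset.univ.erase l := Finset.mem_erase.2 ⟨hq, Finset.mem_univ q⟩
  obtain ⟨w, w₁, hvw, hvw₁, hne⟩ := exists_perp_pair (hPf.nondegenerate hA)
    (hv.linearIndependent hBK)
    (by rw [hc, Fintype.card_coe, hcS, pow_succ, mul_two]) (p := ⟨p, hpS⟩) (q := ⟨q, hqS⟩) (by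
      rw [hv.2 p hpS q hqS, ← comp_single_one i, ← comp_single_one i, pol_map]
      exact (map_ne_zero i).2 hpq)
  have hw : quad A w ≠ 0 := fun h => hne (by rw [hA w h, pol_zero_left])
  obtain ⟨w', hvw', hww⟩ : ∃ w', (∀ j : ↥(Finset.univ.erase l), pol A w' (v j) = 0) ∧
      pol A w w' = quad A w :=
    ⟨(quad A w / pol A w w₁) • w₁, fun j => by rw [pol_smul_left, hvw₁, mul_zero], by
      rw [pol_smul_right, div_mul_cancel₀ _ hne]⟩
  obtain ⟨c', hw'⟩ : ∃ c', quad A w' = c' * quad A w :=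
    ⟨quad A w' / quad A w, (div_mul_cancel₀ _ hw).symm⟩
  obtain ⟨L, _, f, z', hz', hdiag⟩ := exists_artinSchreier_extension h2K c' fun x hx => by
    have h1 : x • w + w' = 0 := hA _ (by
      rw [quad_add, quad_smul, pol_smul_left, hww, hw', ← hx]
      linear_combination (x ^ 2 + x) * quad A w * h2K)
    refine hw ?_
    have h3 : pol A w (x • w + w') = 0 := by rw [h1, pol_zero_right]
    rwa [pol_add_right, pol_smul_right, pol_self, h2K, zero_mul, mul_zero, zero_add, hww] at h3
  obtain ⟨K', _, M', _, i', k, h', hk, hi', hA', v', hv'⟩ := exists_gramOn_insert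
    h2K hA hPf f z' hz' hw hww hw' hBK hv (Finset.notMem_erase l _) (fun j hj => hvw ⟨j, hj⟩)
    (fun j hj => hvw' ⟨j, hj⟩)
  rw [Finset.insert_erase (Finset.mem_univ l)] at hv'
  refine ⟨K', inferInstance, i'.comp i, i' c, ι, inferInstance, A.map i', fun T _ _ d hd => ?_, hc,
    hPf.map i', hA', v', ?_⟩
  · have h1 : IsAniso ((Matrix.diagonal d).map i) := IsAniso.of_map h (by
      rw [← map_map_ringHom]
      exact hi _ _ hd)
    refine IsAniso.of_map h' ?_
    rw [map_map_ringHom, ← map_map_ringHom _ i' h', hi', map_map_ringHom]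
    refine hk _ _ ?_
    rw [Matrix.diagonal_map (map_zero i)] at h1 ⊢
    exact hdiag T _ h1
  · rwa [map_map_ringHom]

end Construction

section Specialization

/-- Nonzero solutions of the equations expressing that `u₀ + u₁ X` is isotropic modulo
`X² + β X + γ` may be specialized along `g`. -/
def Specializes {S T : Type} [CommRing S] [CommRing T] (g : S →+* T) : Prop :=
  ∀ (J : Type) [Fintype J] (B : Matrix J J S) (β γ : S) (u₀ u₁ : J → S), (u₀ ≠ 0 ∨ u₁ ≠ 0) →
    quad B u₀ = γ * quad B u₁ → pol B u₀ u₁ = β * quad B u₁ →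
    ∃ v₀ v₁ : J → T, (v₀ ≠ 0 ∨ v₁ ≠ 0) ∧ quad (B.map g) v₀ = g γ * quad (B.map g) v₁ ∧
      pol (B.map g) v₀ v₁ = g β * quad (B.map g) v₁

variable {S T U : Type} [CommRing S] [CommRing T] [CommRing U]

theorem Specializes.comp {g : T →+* U} {f : S →+* T} (hg : Specializes g) (hf : Specializes f) :
    Specializes (g.comp f) := fun J _ B β γ u₀ u₁ hu h₀ h₁ => by
  obtain ⟨v₀, v₁, hv, h₀, h₁⟩ := hf J B β γ u₀ u₁ hu h₀ h₁
  rw [map_map_ringHom]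
  exact hg J _ _ _ v₀ v₁ hv h₀ h₁

theorem comp_ne_zero_of_injective {J : Type} (g : S →+* T) (hg : Function.Injective g)
    {u : J → S} (hu : u ≠ 0) : g ∘ u ≠ 0 := fun h =>
  hu (funext fun j => hg (by simpa using congrFun h j))

theorem Specializes.of_injective {g : S →+* T} (hg : Function.Injective g) : Specializes g :=
  fun J _ B β γ u₀ u₁ hu h₀ h₁ => ⟨g ∘ u₀, g ∘ u₁,
    hu.imp (comp_ne_zero_of_injective g hg) (comp_ne_zero_of_injective g hg),
    by rw [quad_map, quad_map, h₀, map_mul], by rw [quad_map, pol_map, h₁, map_mul]⟩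

theorem Specializes.eval [IsDomain S] (t : S) : Specializes (Polynomial.evalRingHom t) := by
  intro J _ B β γ u₀ u₁ hu h₀ h₁
  obtain ⟨k, hk⟩ : ∃ k : J ⊕ J, Sum.elim u₀ u₁ k ≠ 0 := by
    rcases hu with hu | hu
    · obtain ⟨j, hj⟩ := Function.ne_iff.1 hu
      exact ⟨Sum.inl j, hj⟩
    · obtain ⟨j, hj⟩ := Function.ne_iff.1 hu
      exact ⟨Sum.inr j, hj⟩
  clear hu
  induction hd : (Sum.elim u₀ u₁ k).natDegree generalizing u₀ u₁ with
  | zero =>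
    refine ⟨Polynomial.evalRingHom t ∘ u₀, Polynomial.evalRingHom t ∘ u₁, ?_, ?_, ?_⟩
    · rw [Polynomial.eq_C_of_natDegree_eq_zero hd] at hk
      by_contra! hcon
      refine hk ?_
      have : Polynomial.evalRingHom t (Sum.elim u₀ u₁ k) = 0 := by
        cases k with
        | inl j => exact congrFun hcon.1 j
        | inr j => exact congrFun hcon.2 j
      rw [Polynomial.eq_C_of_natDegree_eq_zero hd, Polynomial.coe_evalRingHom,
        Polynomial.eval_C] at this
      rw [this, map_zero]
    · rw [quad_map, quad_map, h₀, map_mul]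
    · rw [quad_map, pol_map, h₁, map_mul]
  | succ d ih =>
    by_cases hz : Polynomial.evalRingHom t ∘ u₀ = 0 ∧ Polynomial.evalRingHom t ∘ u₁ = 0
    · choose w₀ hw₀ using fun j => Polynomial.dvd_iff_isRoot.2 (congrFun hz.1 j)
      choose w₁ hw₁ using fun j => Polynomial.dvd_iff_isRoot.2 (congrFun hz.2 j)
      have hX := Polynomial.X_sub_C_ne_zero t
      have h₀' : u₀ = (Polynomial.X - Polynomial.C t) • w₀ := funext hw₀
      have h₁' : u₁ = (Polynomial.X - Polynomial.C t) • w₁ := funext hw₁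
      have hk' : Sum.elim u₀ u₁ k = (Polynomial.X - Polynomial.C t) * Sum.elim w₀ w₁ k := by
        cases k with
        | inl j => exact hw₀ j
        | inr j => exact hw₁ j
      rw [hk'] at hk hd
      have hk2 := right_ne_zero_of_mul hk
      refine ih w₀ w₁ ?_ ?_ hk2 ?_
      · rw [h₀', h₁', quad_smul, quad_smul] at h₀
        refine mul_left_cancel₀ (pow_ne_zero 2 hX) ?_
        rw [h₀]; ring
      · rw [h₀', h₁', quad_smul, pol_smul_left, pol_smul_right] at h₁
        refine mul_left_cancel₀ (pow_ne_zero 2 hX) ?_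
        rw [pow_two, mul_assoc, h₁]; ring
      · rw [Polynomial.natDegree_mul hX hk2, Polynomial.natDegree_X_sub_C] at hd
        omega
    · exact ⟨Polynomial.evalRingHom t ∘ u₀, Polynomial.evalRingHom t ∘ u₁,
        not_and_or.1 hz, by rw [quad_map, quad_map, h₀, map_mul],
        by rw [quad_map, pol_map, h₁, map_mul]⟩

theorem Specializes.mvEval [IsDomain S] (r : ℕ) (x : Fin r → S) :
    Specializes (MvPolynomial.eval x) := by
  induction r with
  | zero =>
    refine Specializes.of_injective fun p q h => ?_
    rw [MvPolynomial.eq_C_of_isEmpty p, MvPolynomial.eq_C_of_isEmpty q] at h ⊢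
    simpa using h
  | succ r ih =>
    have h : MvPolynomial.eval x = ((MvPolynomial.eval (Fin.tail x)).comp
        (Polynomial.evalRingHom (MvPolynomial.C (x 0)))).comp
          (MvPolynomial.finSuccEquiv S r : MvPolynomial (Fin (r + 1)) S →+* _) := by
      refine MvPolynomial.ringHom_ext (fun a => ?_) fun i => ?_
      · simp [MvPolynomial.finSuccEquiv_apply]
      · refine Fin.cases ?_ (fun i => ?_) i <;>
          simp [MvPolynomial.finSuccEquiv_apply, Fin.tail]
    rw [h]
    exact ((ih _).comp (Specializes.eval _)).comp
      (Specializes.of_injective (MvPolynomial.finSuccEquiv S r).injective)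

end Specialization

section Monic

variable {S : Type} [CommRing S] [Nontrivial S]

/-- A vector over `S[X]` is congruent to one with linear entries modulo a monic quadratic. -/
theorem exists_linear_modByMonic {J : Type} {P : Polynomial S} (hP : P.Monic)
    (hdeg : P.degree = 2) (U : J → Polynomial S) : ∃ (Q : J → Polynomial S) (u₀ u₁ : J → S),
      U = P • Q + (Polynomial.C ∘ u₀ + (Polynomial.X : Polynomial S) • (Polynomial.C ∘ u₁)) := by
  refine ⟨fun j => U j /ₘ P, fun j => (U j %ₘ P).coeff 0, fun j => (U j %ₘ P).coeff 1,
    funext fun j => ?_⟩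
  have h1 : (U j %ₘ P).degree < 2 := hdeg ▸ Polynomial.degree_modByMonic_lt _ hP
  conv_lhs => rw [← Polynomial.modByMonic_add_div (U j) P,
    Polynomial.eq_X_add_C_of_degree_le_one (Order.le_of_lt_succ h1)]
  simp only [Pi.add_apply, Pi.smul_apply, smul_eq_mul, Function.comp_apply]
  ring

theorem exists_linear_of_dvd {J : Type} [Fintype J] {B : Matrix J J S} {β γ : S}
    {P : Polynomial S} (hP : P = Polynomial.C 1 * Polynomial.X ^ 2 +
      Polynomial.C β * Polynomial.X + Polynomial.C γ) (U : J → Polynomial S)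
    (hU : ∃ j, ¬ P ∣ U j) (hd : P ∣ quad (B.map Polynomial.C) U) :
    ∃ u₀ u₁ : J → S, (u₀ ≠ 0 ∨ u₁ ≠ 0) ∧ quad B u₀ = γ * quad B u₁ ∧
      pol B u₀ u₁ = β * quad B u₁ := by
  have hdeg : P.degree = 2 := by rw [hP, Polynomial.degree_quadratic one_ne_zero]
  have hmonic : P.Monic := by
    rw [Polynomial.Monic, hP, Polynomial.leadingCoeff_quadratic one_ne_zero]
  obtain ⟨Q, u₀, u₁, rfl⟩ := exists_linear_modByMonic hmonic hdeg U
  rw [quad_add, quad_smul, pol_smul_left, pow_two, mul_assoc, add_right_comm, ← mul_add,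
    dvd_add_right (dvd_mul_right _ _), quad_add, quad_smul, pol_smul_right, quad_map, quad_map,
    pol_map] at hd
  have hd2 : P ∣ Polynomial.C (pol B u₀ u₁ - β * quad B u₁) * Polynomial.X +
      Polynomial.C (quad B u₀ - γ * quad B u₁) := by
    have := dvd_sub hd (Dvd.intro (Polynomial.C (quad B u₁)) rfl)
    refine this.trans (Eq.dvd ?_)
    rw [hP]
    simp only [map_sub, map_mul, map_one]
    ring
  have hz : Polynomial.C (pol B u₀ u₁ - β * quad B u₁) * Polynomial.X +
      Polynomial.C (quad B u₀ - γ * quad B u₁) = 0 := by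
    by_contra hne
    exact hmonic.not_dvd_of_degree_lt hne
      (hdeg ▸ Polynomial.degree_linear_le.trans_lt (by norm_num)) hd2
  refine ⟨u₀, u₁, ?_, ?_, ?_⟩
  · by_contra! hcon
    obtain ⟨j, hj⟩ := hU
    refine hj ⟨Q j, ?_⟩
    simp [hcon.1, hcon.2]
  · have := congrArg (fun p => Polynomial.coeff p 0) hz
    simpa [sub_eq_zero] using this
  · have := congrArg (fun p => Polynomial.coeff p 1) hz
    simpa [sub_eq_zero] using this

end Monic

section BaseChange

variable {F S T : Type} [Field F] [CommRing S] [CommRing T] {J J' : Type} [Fintype J]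
  [DecidableEq J]

/-- The extension of a linear map along a homomorphism of the scalars. -/
def baseChange (f : F →+* S) (E : (J → F) →ₗ[F] (J' → F)) (r : J → S) : J' → S :=
  ∑ j, r j • (f ∘ E (Pi.single j 1))

theorem baseChange_apply (f : F →+* S) (E : (J → F) →ₗ[F] (J' → F)) (r : J → S) (k : J') :
    baseChange f E r k = ∑ j, r j * f (E (Pi.single j 1) k) := by
  simp [baseChange]

theorem linearMap_apply_eq_sum (E : (J → F) →ₗ[F] (J' → F)) (x : J → F) (i : J') :
    E x i = ∑ k, x k * E (Pi.single k 1) i := by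
  conv_lhs => rw [pi_eq_sum_univ' x, map_sum]
  simp

theorem comp_baseChange (g : S →+* T) (f : F →+* S) (E : (J → F) →ₗ[F] (J' → F)) (r : J → S) :
    g ∘ baseChange f E r = baseChange (g.comp f) E (g ∘ r) := by
  ext k
  simp [baseChange_apply]

theorem baseChange_symm_baseChange [Fintype J'] [DecidableEq J'] (f : F →+* S)
    (E : (J → F) ≃ₗ[F] (J' → F)) (r : J → S) :
    baseChange f (E.symm : (J' → F) →ₗ[F] (J → F)) (baseChange f (E : (J → F) →ₗ[F] (J' → F)) r) =
      r := by
  ext i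
  simp only [baseChange_apply, Finset.sum_mul]
  rw [Finset.sum_comm]
  have h : ∀ j, ∑ k, r j * f (E (Pi.single j 1) k) * f (E.symm (Pi.single k 1) i) =
      r j * f ((Pi.single j 1 : J → F) i) := fun j => by
    have h1 := linearMap_apply_eq_sum (E.symm : (J' → F) →ₗ[F] (J → F)) (E (Pi.single j 1)) i
    simp only [LinearEquiv.coe_coe, LinearEquiv.symm_apply_apply] at h1
    rw [h1, map_sum, Finset.mul_sum]
    simp only [map_mul, mul_assoc]
  simp only [LinearEquiv.coe_coe, h, Pi.single_apply]
  simp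

end BaseChange

section CoeffMat

theorem quad_single_one {R J : Type*} [CommRing R] [Fintype J] [DecidableEq J] (A : Matrix J J R)
    (j : J) : quad A (Pi.single j 1) = A j j := by
  simp [quad, Pi.single_apply]

theorem pol_single_one {R J : Type*} [CommRing R] [Fintype J] [DecidableEq J] (A : Matrix J J R)
    (j k : J) : pol A (Pi.single j 1) (Pi.single k 1) = A j k + A k j := by
  simp [pol, Pi.single_apply, mul_add, Finset.sum_add_distrib]

theorem toQuadraticForm'_eq_quad {R J : Type*} [CommRing R] [Fintype J] [DecidableEq J]
    (A : Matrix J J R) (x : J → R) : A.toQuadraticForm' x = quad A x := by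
  rw [quad_eq_dotProduct]
  exact Matrix.toLinearMap₂'_apply' _ _ _

variable {F : Type} [Field F]

theorem gramOn_coeffMat {N : ℕ} (φ : QuadraticForm F (Fin N → F)) {J : Type} [Fintype J]
    {A : Matrix J J F} (E : (Fin N → F) →ₗ[F] (J → F)) (hE : ∀ x, φ x = quad A (E x)) :
    GramOn A (coeffMat F φ) Finset.univ fun j => E (Pi.single j 1) := by
  have hq : ∀ j, quad A (E (Pi.single j 1)) = quad (coeffMat F φ) (Pi.single j 1) := fun j => by
    rw [← hE, quad_single_one]
    simp [coeffMat]
  have hp : ∀ j k, j < k → pol A (E (Pi.single j 1)) (E (Pi.single k 1)) =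
      pol (coeffMat F φ) (Pi.single j 1) (Pi.single k 1) := fun j k h => by
    rw [pol_single_one, pol_eq_sub, ← map_add, ← hE, ← hE, ← hE]
    simp [coeffMat, h.ne, h.ne', h, h.not_gt, polar]
  refine ⟨fun j _ => hq j, fun j _ k _ => ?_⟩
  rcases lt_trichotomy j k with h | rfl | h
  · exact hp j k h
  · rw [pol_self, pol_self, hq]
  · rw [pol_comm, hp k j h, pol_comm]

theorem quad_baseChange {N : ℕ} (φ : QuadraticForm F (Fin N → F)) {J : Type} [Fintype J]
    {A : Matrix J J F} (E : (Fin N → F) →ₗ[F] (J → F)) (hE : ∀ x, φ x = quad A (E x))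
    {S : Type} [CommRing S] (f : F →+* S) (r : Fin N → S) :
    quad (A.map f) (baseChange f E r) = quad ((coeffMat F φ).map f) r :=
  ((gramOn_coeffMat φ E hE).map f).quad_sum_univ r

theorem qfPoly_eq_quad {N : ℕ} (ψ : QuadraticForm F (Fin N → F)) :
    qfPoly F ψ = quad ((coeffMat F ψ).map (C : F →+* MvPolynomial (Fin N) F)) X := by
  simp only [qfPoly, quad, Matrix.map_apply, mul_assoc]

/-- The matrix of `[a,b] ⊥ ⟨c₁, …, c_s⟩`. -/
def typeMat {s : ℕ} (a b : F) (c : Fin s → F) : Matrix (Fin 2 ⊕ Fin s) (Fin 2 ⊕ Fin s) F :=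
  Matrix.fromBlocks !![a, 1; 0, b] 0 0 (Matrix.diagonal c)

theorem quad_typeMat_map {s : ℕ} (a b : F) (c : Fin s → F) {S : Type} [CommRing S] (f : F →+* S)
    (x : Fin 2 ⊕ Fin s → S) : quad ((typeMat a b c).map f) x = f a * x (Sum.inl 0) ^ 2 +
      x (Sum.inl 0) * x (Sum.inl 1) + f b * x (Sum.inl 1) ^ 2 +
      ∑ j, f (c j) * x (Sum.inr j) ^ 2 := by
  simp [quad, typeMat, Fintype.sum_sum_type, Fin.sum_univ_two, Matrix.diagonal_apply,
    apply_ite f, pow_two, mul_assoc]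

theorem quad_typeMat {s : ℕ} (a b : F) (c : Fin s → F) (x : Fin 2 ⊕ Fin s → F) :
    quad (typeMat a b c) x = a * x (Sum.inl 0) ^ 2 + x (Sum.inl 0) * x (Sum.inl 1) +
      b * x (Sum.inl 1) ^ 2 + ∑ j, c j * x (Sum.inr j) ^ 2 := by
  simpa [map_ringHom_id] using quad_typeMat_map a b c (RingHom.id F) x

theorem pol_typeMat_map {s : ℕ} (h2 : (2 : F) = 0) (a b : F) (c : Fin s → F) {S : Type}
    [CommRing S] (f : F →+* S) (x y : Fin 2 ⊕ Fin s → S) :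
    pol ((typeMat a b c).map f) x y =
      x (Sum.inl 0) * y (Sum.inl 1) + x (Sum.inl 1) * y (Sum.inl 0) := by
  have h2S : (2 : S) = 0 := two_eq_zero_of_map f h2
  have h : pol ((typeMat a b c).map f) x y =
      x (Sum.inl 0) * y (Sum.inl 1) + x (Sum.inl 1) * y (Sum.inl 0) +
      2 * (f a * x (Sum.inl 0) * y (Sum.inl 0) + f b * x (Sum.inl 1) * y (Sum.inl 1) +
        ∑ j, f (c j) * x (Sum.inr j) * y (Sum.inr j)) := by
    simp [pol, typeMat, Fintype.sum_sum_type, Fin.sum_univ_two, Matrix.diagonal_apply,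
      apply_ite f]
    have hs : ∑ j, f (c j) * (x (Sum.inr j) * y (Sum.inr j) + y (Sum.inr j) * x (Sum.inr j)) =
        2 * ∑ j, f (c j) * x (Sum.inr j) * y (Sum.inr j) := by
      rw [Finset.mul_sum]
      exact Finset.sum_congr rfl fun j _ => by ring
    linear_combination hs
  rw [h, h2S, zero_mul, add_zero]

theorem exists_typeMat {s : ℕ} {φ : QuadraticForm F (Fin (2 + s) → F)} (h : HasTypeRS φ 1 s) :
    ∃ (a b : F) (c : Fin s → F) (E : (Fin (2 + s) → F) ≃ₗ[F] (Fin 2 ⊕ Fin s → F)),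
      ∀ x, φ x = quad (typeMat a b c) (E x) := by
  obtain ⟨a, b, c, ⟨e⟩⟩ := h
  refine ⟨a 0, b 0, c, e.toLinearEquiv.trans
    (((LinearEquiv.funUnique (Fin 1) F (Fin 2 → F)).prodCongr
      (LinearEquiv.refl F (Fin s → F))).trans
      (LinearEquiv.sumArrowLequivProdArrow (Fin 2) (Fin s) F F).symm), fun x => ?_⟩
  have h1 := e.map_app x
  rw [← h1, quad_typeMat]
  have hq : ∀ y, (Matrix.of ![![a 0, 1], ![0, b 0]]).toQuadraticForm' y =
      a 0 * y 0 ^ 2 + y 0 * y 1 + b 0 * y 1 ^ 2 := fun y => by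
    rw [toQuadraticForm'_eq_quad]
    simp [quad, Fin.sum_univ_two]
    ring
  have hb : binsQF a b (e x).1 = a 0 * (e x).1 0 0 ^ 2 + (e x).1 0 0 * (e x).1 0 1 +
      b 0 * (e x).1 0 1 ^ 2 :=
    (QuadraticMap.pi_apply _ _).trans (by rw [Fin.sum_univ_one]; exact hq ((e x).1 0))
  have hd : diagQF c (e x).2 = ∑ j, c j * ((e x).2 j * (e x).2 j) :=
    weightedSumSquares_apply _ _
  rw [QuadraticMap.prod_apply, hb, hd]
  simp [pow_two]

end CoeffMat

section FunctionField

theorem exists_lift_of_isotropic {R S T K : Type} [CommRing R] [CommRing S] [CommRing T]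
    [CommRing K] [Algebra T K] [IsFractionRing T K] (g : R →+* S) {q : S →+* T}
    (hq : Function.Surjective q) {J : Type} [Fintype J] (A : Matrix J J R) (x : J → K)
    (hx : x ≠ 0) (h : quad (A.map ((algebraMap T K).comp (q.comp g))) x = 0) :
    ∃ U : J → S, (∃ j, q (U j) ≠ 0) ∧ q (quad (A.map g) U) = 0 := by
  obtain ⟨b, hb⟩ := IsLocalization.exist_integer_multiples_of_finite (nonZeroDivisors T) x
  choose y hy using hb
  choose U hU using fun j => hq (y j)
  have hU' : q ∘ U = y := funext hU
  have hy' : algebraMap T K ∘ y = algebraMap T K b • x := funext fun j => by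
    rw [Function.comp_apply, hy, Algebra.smul_def, Pi.smul_apply, smul_eq_mul]
  refine ⟨U, ?_, ?_⟩
  · by_contra! hcon
    refine hx (funext fun j => ?_)
    have h0 : y j = 0 := by rw [← hU, hcon j]
    have h1 := congrFun hy' j
    rw [Function.comp_apply, h0, map_zero, Pi.smul_apply, smul_eq_mul] at h1
    exact (IsLocalization.map_units K b).mul_right_eq_zero.1 h1.symm
  · rw [← quad_map, hU', ← map_map_ringHom]
    refine IsFractionRing.injective T K ?_
    rw [← quad_map, ← map_map_ringHom, hy', quad_smul, h, mul_zero, map_zero]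

variable {F : Type} [Field F]

theorem extendQF_apply {N : ℕ} {K : Type} [CommRing K] (f : F →+* K)
    (φ : QuadraticForm F (Fin N → F)) (x : Fin N → K) :
    extendQF F f φ x = quad ((coeffMat F φ).map f) x :=
  toQuadraticForm'_eq_quad _ x

instance {N : ℕ} (ψ : QuadraticForm F (Fin N → F)) :
    IsFractionRing (FunFieldRing F ψ) (FunField F ψ) :=
  inferInstanceAs (IsFractionRing (MvPolynomial (Fin N) F ⧸ Ideal.span {qfPoly F ψ})
    (FractionRing (MvPolynomial (Fin N) F ⧸ Ideal.span {qfPoly F ψ})))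

/-- The projection of the polynomial ring to the coordinate ring of the quadric. -/
noncomputable def funFieldRingMk {N : ℕ} (ψ : QuadraticForm F (Fin N → F)) :
    MvPolynomial (Fin N) F →+* FunFieldRing F ψ :=
  Ideal.Quotient.mk (Ideal.span {qfPoly F ψ})

theorem funFieldMap_eq {N : ℕ} (ψ : QuadraticForm F (Fin N → F)) :
    funFieldMap F ψ =
      (algebraMap (FunFieldRing F ψ) (FunField F ψ)).comp ((funFieldRingMk ψ).comp C) :=
  rfl

theorem exists_lift_of_not_anisotropic {N M : ℕ} {φ : QuadraticForm F (Fin N → F)}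
    {ψ : QuadraticForm F (Fin M → F)} {J : Type} [Fintype J] [DecidableEq J] {A : Matrix J J F}
    (E : (Fin N → F) ≃ₗ[F] (J → F)) (hE : ∀ x, φ x = quad A (E x))
    (h : ¬ (extendQF F (funFieldMap F ψ) φ).Anisotropic) :
    ∃ U : J → MvPolynomial (Fin M) F, (∃ j, ¬ qfPoly F ψ ∣ U j) ∧
      qfPoly F ψ ∣ quad (A.map (C : F →+* MvPolynomial (Fin M) F)) U := by
  obtain ⟨x, hx0, hx⟩ : ∃ x, extendQF F (funFieldMap F ψ) φ x = 0 ∧ x ≠ 0 := by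
    simpa [QuadraticMap.Anisotropic] using h
  have hz : ∀ p, funFieldRingMk ψ p = 0 ↔ qfPoly F ψ ∣ p := fun p =>
    Ideal.Quotient.eq_zero_iff_mem.trans Ideal.mem_span_singleton
  simp only [← hz]
  rw [extendQF_apply, ← quad_baseChange φ E.toLinearMap hE, funFieldMap_eq] at hx0
  have hsurj : Function.Surjective (funFieldRingMk ψ) := Ideal.Quotient.mk_surjective
  refine exists_lift_of_isotropic C hsurj A _ (fun h0 => hx ?_) hx0
  rw [← baseChange_symm_baseChange _ E x, h0]
  ext k
  simp [baseChange_apply]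

variable {s s' : ℕ}

/-- The point `(X, y, w)` with generic coordinates, over the ring of polynomials in the first
coordinate. -/
noncomputable def genericPoint (F : Type) [Field F] (s' : ℕ) :
    Fin 2 ⊕ Fin s' → Polynomial (MvPolynomial (Fin (s' + 1)) F) :=
  Sum.elim ![Polynomial.X, Polynomial.C (X 0)] fun j => Polynomial.C (X j.succ)

/-- Coordinates in which `ψ` becomes a polynomial in the first variable. -/
noncomputable def genericHom (E : (Fin (2 + s') → F) ≃ₗ[F] (Fin 2 ⊕ Fin s' → F)) :
    MvPolynomial (Fin (2 + s')) F →+* Polynomial (MvPolynomial (Fin (s' + 1)) F) :=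
  MvPolynomial.eval₂Hom (Polynomial.C.comp C)
    (baseChange (Polynomial.C.comp C) E.symm.toLinearMap (genericPoint F s'))

/-- The inverse of `genericHom`. -/
noncomputable def genericHomInv (E : (Fin (2 + s') → F) ≃ₗ[F] (Fin 2 ⊕ Fin s' → F)) :
    Polynomial (MvPolynomial (Fin (s' + 1)) F) →+* MvPolynomial (Fin (2 + s')) F :=
  Polynomial.eval₂RingHom (MvPolynomial.eval₂Hom C (Fin.cons
    (baseChange C E.toLinearMap X (Sum.inl 1))
    fun j => baseChange C E.toLinearMap X (Sum.inr j)))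
    (baseChange C E.toLinearMap X (Sum.inl 0))

theorem genericHomInv_genericHom (E : (Fin (2 + s') → F) ≃ₗ[F] (Fin 2 ⊕ Fin s' → F))
    (p : MvPolynomial (Fin (2 + s')) F) : genericHomInv E (genericHom E p) = p := by
  have hC : (genericHomInv E).comp (Polynomial.C.comp C) = C := by
    ext1 x
    simp [genericHomInv]
  have hpt : genericHomInv E ∘ genericPoint F s' = baseChange C E.toLinearMap X := by
    ext1 k
    rcases k with k | k
    · fin_cases k <;> simp [genericHomInv, genericPoint]
    · simp [genericHomInv, genericPoint]
  have h : (genericHomInv E).comp (genericHom E) = RingHom.id _ := by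
    refine MvPolynomial.ringHom_ext (fun x => ?_) fun i => ?_
    · simpa [genericHom] using congrArg (fun f : F →+* _ => f x) hC
    · have h1 := comp_baseChange (genericHomInv E) (Polynomial.C.comp C)
        E.symm.toLinearMap (genericPoint F s')
      rw [hC, hpt, baseChange_symm_baseChange] at h1
      simpa [genericHom] using congrFun h1 i
  exact congrArg (fun f : MvPolynomial (Fin (2 + s')) F →+* _ => f p) h

theorem genericHom_qfPoly {ψ : QuadraticForm F (Fin (2 + s') → F)}
    {B : Matrix (Fin 2 ⊕ Fin s') (Fin 2 ⊕ Fin s') F}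
    (E : (Fin (2 + s') → F) ≃ₗ[F] (Fin 2 ⊕ Fin s' → F)) (hE : ∀ x, ψ x = quad B (E x)) :
    genericHom E (qfPoly F ψ) = quad (B.map (Polynomial.C.comp C)) (genericPoint F s') := by
  have h : baseChange (Polynomial.C.comp C) E.toLinearMap
      (baseChange (Polynomial.C.comp C) E.symm.toLinearMap (genericPoint F s')) = _ :=
    baseChange_symm_baseChange (Polynomial.C.comp C) E.symm (genericPoint F s')
  rw [qfPoly_eq_quad, ← quad_map, ← map_map_ringHom]
  have hC : (genericHom E).comp C = Polynomial.C.comp C := by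
    ext1 x
    simp [genericHom]
  have hX : genericHom E ∘ X =
      baseChange (Polynomial.C.comp C) E.symm.toLinearMap (genericPoint F s') := by
    ext1 k
    simp [genericHom]
  rw [hC, hX, ← quad_baseChange ψ E.toLinearMap hE, h]

/-- If `φ` becomes isotropic over `F(ψ)`, then over every extension of `F` it has a vector
`v₀ + v₁ X` that is isotropic modulo any specialization of the dehomogenized polynomial of `ψ`. -/
theorem exists_linear_of_not_anisotropic {N : ℕ} {φ : QuadraticForm F (Fin N → F)}
    {ψ : QuadraticForm F (Fin (2 + s') → F)} {J : Type} [Fintype J] [DecidableEq J]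
    {A : Matrix J J F} (Eφ : (Fin N → F) ≃ₗ[F] (J → F)) (hEφ : ∀ x, φ x = quad A (Eφ x))
    {a b : F} {c : Fin s' → F} (ha : a ≠ 0)
    (Eψ : (Fin (2 + s') → F) ≃ₗ[F] (Fin 2 ⊕ Fin s' → F))
    (hEψ : ∀ x, ψ x = quad (typeMat a b c) (Eψ x))
    (h : ¬ (extendQF F (funFieldMap F ψ) φ).Anisotropic)
    {L : Type} [Field L] (f : F →+* L) (y : L) (w : Fin s' → L) :
    ∃ v₀ v₁ : J → L, (v₀ ≠ 0 ∨ v₁ ≠ 0) ∧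
      quad (A.map f) v₀ = f a⁻¹ * (f b * y ^ 2 + ∑ j, f (c j) * w j ^ 2) * quad (A.map f) v₁ ∧
      pol (A.map f) v₀ v₁ = f a⁻¹ * y * quad (A.map f) v₁ := by
  obtain ⟨U, ⟨j, hj⟩, hU⟩ := exists_lift_of_not_anisotropic Eφ hEφ h
  set β : MvPolynomial (Fin (s' + 1)) F := C a⁻¹ * X 0 with hβ
  set γ : MvPolynomial (Fin (s' + 1)) F :=
    C a⁻¹ * (C b * X 0 ^ 2 + ∑ j, C (c j) * X (Fin.succ j) ^ 2) with hγ
  set P := Polynomial.C 1 * Polynomial.X ^ 2 + Polynomial.C β * Polynomial.X + Polynomial.C γ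
    with hP
  have hC : (C a * C a⁻¹ : MvPolynomial (Fin (s' + 1)) F) = 1 := by
    rw [← map_mul, mul_inv_cancel₀ ha, map_one]
  have hgen : genericHom Eψ (qfPoly F ψ) = Polynomial.C (C a) * P := by
    rw [genericHom_qfPoly Eψ hEψ, quad_typeMat_map, hP, hβ, hγ]
    have hC' := congrArg (Polynomial.C) hC
    simp only [map_mul, map_one] at hC'
    simp [genericPoint]
    linear_combination (-(Polynomial.C (X 0) * Polynomial.X +
      Polynomial.C (C b) * Polynomial.C (X 0) ^ 2 +
      ∑ x, Polynomial.C (C (c x)) * Polynomial.C (X (Fin.succ x)) ^ 2)) * hC'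
  have hP1 : P = Polynomial.C (C a⁻¹) * genericHom Eψ (qfPoly F ψ) := by
    rw [hgen, ← mul_assoc, ← map_mul, mul_comm (C _), hC, map_one, one_mul]
  have hj' : ¬ P ∣ genericHom Eψ (U j) := fun hd => hj <| by
    have hd' : genericHom Eψ (qfPoly F ψ) ∣ genericHom Eψ (U j) :=
      (Dvd.intro_left _ hP1.symm).trans hd
    have := map_dvd (genericHomInv Eψ) hd'
    rwa [genericHomInv_genericHom, genericHomInv_genericHom] at this
  have hU' : P ∣ quad ((A.map C).map Polynomial.C) (genericHom Eψ ∘ U) := by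
    have hq : quad ((A.map C).map Polynomial.C) (genericHom Eψ ∘ U) =
        genericHom Eψ (quad (A.map C) U) := by
      rw [← quad_map, ← map_map_ringHom, ← map_map_ringHom]
      congr 2
      ext1 x
      simp [genericHom]
    rw [hq]
    refine dvd_trans ?_ (map_dvd (genericHom Eψ) hU)
    rw [hgen]
    exact dvd_mul_left _ _
  obtain ⟨u₀, u₁, hu, h₀, h₁⟩ := exists_linear_of_dvd hP (genericHom Eψ ∘ U) ⟨j, hj'⟩ hU'
  obtain ⟨v₀, v₁, hv, h₂, h₃⟩ := (Specializes.mvEval (s' + 1) (Fin.cons y w)).comp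
    (Specializes.of_injective (MvPolynomial.map_injective f f.injective)) J _ β γ u₀ u₁ hu h₀ h₁
  have hf : ((MvPolynomial.eval (Fin.cons y w : Fin (s' + 1) → L)).comp
      (MvPolynomial.map f)).comp C = f := by
    ext1 x
    simp
  rw [← map_map_ringHom, hf] at h₂ h₃
  refine ⟨v₀, v₁, hv, ?_, ?_⟩
  · simpa [hγ] using h₂
  · simpa [hβ] using h₃

end FunctionField

section Contradiction

variable {K : Type} [Field K] {ι : Type*} [Fintype ι]

/-- Vectors orthogonal to a Lagrangian subspace are orthogonal to each other. -/
theorem pol_eq_zero_of_perp_of_card_le {A : Matrix ι ι K} (hA : PolNondeg A) {J : Type*}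
    [Fintype J] {t : J → ι → K} (ht : LinearIndependent K t) (htt : ∀ j k, pol A (t j) (t k) = 0)
    (hcard : Fintype.card ι ≤ 2 * Fintype.card J) {x y : ι → K} (hx : ∀ j, pol A x (t j) = 0)
    (hy : ∀ j, pol A y (t j) = 0) : pol A x y = 0 := by
  have hle : Submodule.span K (Set.range t) ≤ perp A t := by
    rw [Submodule.span_le]
    rintro _ ⟨j, rfl⟩
    exact mem_perp.2 (htt j)
  have heq : Submodule.span K (Set.range t) = perp A t := by
    refine Submodule.eq_of_le_of_finrank_le hle ?_
    rw [finrank_perp hA ht, finrank_span_eq_card ht]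
    omega
  have hmem : x ∈ Submodule.span K (Set.range t) := heq ▸ mem_perp.2 hx
  obtain ⟨r, rfl⟩ := (Submodule.mem_span_range_iff_exists_fun K).1 hmem
  rw [pol_comm, pol_sum_right]
  exact Finset.sum_eq_zero fun j _ => by rw [pol_smul_right, hy, mul_zero]

theorem linearIndependent_of_isAniso_diagonal {A : Matrix ι ι K} {J : Type*} [Fintype J]
    [DecidableEq J] {d : J → K} (hd : IsAniso (Matrix.diagonal d)) {t : J → ι → K}
    (ht : ∀ j, quad A (t j) = d j) (htt : ∀ j k, pol A (t j) (t k) = pol (Matrix.diagonal d)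
      (Pi.single j 1) (Pi.single k 1)) : LinearIndependent K t := by
  have h : GramOn A (Matrix.diagonal d) Finset.univ t :=
    ⟨fun j _ => by rw [ht, quad_single_one, Matrix.diagonal_apply_eq], fun j _ k _ => htt j k⟩
  exact (linearIndependent_equiv (Equiv.subtypeUnivEquiv Finset.mem_univ)).1
    (h.linearIndependent hd)

theorem quad_smul_map {J : Type*} [Fintype J] {F S : Type*} [CommRing F] [CommRing S]
    (B : Matrix J J F) (a : F) (f : F →+* S) (x : J → S) :
    quad ((a • B).map f) x = f a * quad (B.map f) x := by
  simp [quad, Finset.mul_sum, mul_assoc]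

theorem pol_smul_map {J : Type*} [Fintype J] {F S : Type*} [CommRing F] [CommRing S]
    (B : Matrix J J F) (a : F) (f : F →+* S) (x y : J → S) :
    pol ((a • B).map f) x y = f a * pol (B.map f) x y := by
  simp [pol, Finset.mul_sum, mul_assoc]

variable {F : Type} [Field F] {s : ℕ}

theorem IsAniso.diagonal_of_typeMat {a b : F} {c : Fin s → F} (h : IsAniso (typeMat a b c)) :
    IsAniso (Matrix.diagonal c) := fun x hx => by
  have h1 := h (Sum.elim 0 x) (by rw [quad_typeMat]; simpa [quad_diagonal] using hx)
  exact funext fun j => congrFun h1 (Sum.inr j)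

theorem IsAniso.left_ne_zero_of_typeMat {a b : F} {c : Fin s → F} (h : IsAniso (typeMat a b c)) :
    a ≠ 0 := by
  rintro rfl
  have h1 := h (Pi.single (Sum.inl 0) 1) (by simp [quad_single_one, typeMat])
  simpa using congrFun h1 (Sum.inl 0)

theorem isAniso_of_anisotropic {N : ℕ} {φ : QuadraticForm F (Fin N → F)} {J : Type} [Fintype J]
    {A : Matrix J J F} (E : (Fin N → F) ≃ₗ[F] (J → F)) (hE : ∀ x, φ x = quad A (E x))
    (h : φ.Anisotropic) : IsAniso A := fun x hx => by
  have h1 := h (E.symm x) (by rw [hE, E.apply_symm_apply, hx])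
  simpa using h1

/-- A form of type `(1,s)` embedded in an anisotropic form over an extension over which its
diagonal part stays anisotropic is anisotropic over that extension. -/
theorem GramOn.isAniso_typeMat (h2 : (2 : F) = 0) {a b : F} {c : Fin s → F} {f : F →+* K}
    {A : Matrix ι ι K} {v : Fin 2 ⊕ Fin s → ι → K}
    (hv : GramOn A ((typeMat a b c).map f) Finset.univ v) (hA : IsAniso A)
    (hc : IsAniso ((Matrix.diagonal c).map f)) : IsAniso ((typeMat a b c).map f) := fun u hu => by
  have hz : ∑ j, u j • v j = 0 := hA _ (by rw [hv.quad_sum_univ, hu])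
  have hpol : ∀ t, pol ((typeMat a b c).map f) u t = 0 := fun t => by
    rw [← hv.pol_sum_univ, hz, pol_zero_left]
  have h1 := hpol (Pi.single (Sum.inl 0) 1)
  have h0 := hpol (Pi.single (Sum.inl 1) 1)
  simp only [pol_typeMat_map h2, Pi.single_apply] at h0 h1
  simp at h0 h1
  rw [quad_typeMat_map, h0, h1] at hu
  have hr := hc (u ∘ Sum.inr) (by
    rw [Matrix.diagonal_map (map_zero f), quad_diagonal]
    simpa using hu)
  funext j
  rcases j with j | j
  · fin_cases j
    · exact h0
    · exact h1
  · exact congrFun hr j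

theorem not_exists_linear (h2 : (2 : F) = 0) {n s' : ℕ} (hn : 1 ≤ n) (hs : 2 + s = 2 ^ n + 1)
    (hs' : 2 ^ n + 1 < 2 + s') {a₀ b₀ a b : F} {c₀ : Fin s → F} {c : Fin s' → F}
    (hφ : IsAniso (typeMat a₀ b₀ c₀)) (hψ : IsAniso (typeMat a b c))
    (h : ∀ (L : Type) [Field L] (f : F →+* L) (y : L) (w : Fin s' → L),
      ∃ v₀ v₁ : Fin 2 ⊕ Fin s → L, (v₀ ≠ 0 ∨ v₁ ≠ 0) ∧
        quad ((typeMat a₀ b₀ c₀).map f) v₀ = f a⁻¹ * (f b * y ^ 2 + ∑ j, f (c j) * w j ^ 2) *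
          quad ((typeMat a₀ b₀ c₀).map f) v₁ ∧
        pol ((typeMat a₀ b₀ c₀).map f) v₀ v₁ =
          f a⁻¹ * y * quad ((typeMat a₀ b₀ c₀).map f) v₁) : False := by
  have hn2 : 2 ^ 1 ≤ 2 ^ n := Nat.pow_le_pow_right (by norm_num) hn
  have ha := hψ.left_ne_zero_of_typeMat
  obtain ⟨K, _, i, c₁, ι, _, A, hi, hcard, hPf, hA, v, hv⟩ := exists_gramOn_univ h2 hφ n
    (J := Fin 2 ⊕ Fin s) (by simpa using hs) (p := Sum.inl 0) (q := Sum.inl 1)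
    (l := Sum.inr ⟨0, by omega⟩) (by simp) (by simp) (by simp [pol_single_one, typeMat])
  have hrep : ∀ (L : Type) [Field L] (f : K →+* L), AnisoExt f → ∀ x : Fin 2 ⊕ Fin s' → L,
      ∃ u, quad (A.map f) u = quad (((a⁻¹ • typeMat a b c).map i).map f) x := by
    intro L _ f hf x
    have hAL := hf ι A hA
    have hvL : GramOn (A.map f) ((typeMat a₀ b₀ c₀).map (f.comp i)) Finset.univ
        fun j => f ∘ v j := hv.map f
    have hΦ := hvL.isAniso_typeMat h2 hAL (by
      rw [map_map_ringHom]
      exact hf _ _ (hi _ _ hφ.diagonal_of_typeMat))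
    obtain ⟨v₀, v₁, hne, h₀, h₁⟩ := h L (f.comp i) (x (Sum.inl 1)) (x ∘ Sum.inr)
    have hv₁ : quad ((typeMat a₀ b₀ c₀).map (f.comp i)) v₁ ≠ 0 := fun h0 => by
      rw [h0, mul_zero] at h₀
      exact hne.elim (fun h => h (hΦ _ h₀)) fun h => h (hΦ _ h0)
    obtain ⟨u, hu⟩ := (hPf.map f).exists_div hAL (∑ j, (v₀ + x (Sum.inl 0) • v₁) j • (f ∘ v j))
      (∑ j, v₁ j • (f ∘ v j))
    refine ⟨u, ?_⟩
    rw [hu, hvL.quad_sum_univ, hvL.quad_sum_univ, quad_add, quad_smul, pol_smul_right, h₀, h₁,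
      ← map_map_ringHom, quad_smul_map, div_eq_iff hv₁, quad_typeMat_map a b]
    have haL : f.comp i a⁻¹ * f.comp i a = 1 := by rw [← map_mul, inv_mul_cancel₀ ha, map_one]
    simp only [Function.comp_apply]
    linear_combination (-(x (Sum.inl 0) ^ 2 *
      quad ((typeMat a₀ b₀ c₀).map (f.comp i)) v₁)) * haL
  obtain ⟨w, hw, hww⟩ := exists_isometric_family (A := A)
    (B := (a⁻¹ • typeMat a b c).map i) (fun _ _ f => AnisoExt f)
    AnisoExt.id (fun _ _ _ hf => AnisoExt.ratFuncC.comp hf) (fun _ _ f hf => hf ι A hA) hrep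
    (fun j => Pi.single j 1)
  have hww' : ∀ j k, pol A (w j) (w k) = i a⁻¹ * pol ((typeMat a b c).map i) (Pi.single j 1)
      (Pi.single k 1) := fun j k => by rw [hww, pol_smul_map]
  have h2K : (2 : K) = 0 := two_eq_zero_of_map i h2
  have hd : IsAniso (Matrix.diagonal fun j => i (a⁻¹ * c j)) := fun x hx => by
    have hc := hi _ c hψ.diagonal_of_typeMat
    rw [Matrix.diagonal_map (map_zero i)] at hc
    refine hc x ?_
    rw [quad_diagonal] at hx ⊢
    simp only [map_mul, mul_assoc, ← Finset.mul_sum] at hx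
    exact (mul_eq_zero.1 hx).resolve_left (by simpa using ha)
  have htt : ∀ j k : Fin s', pol A (w (Sum.inr j)) (w (Sum.inr k)) = 0 := fun j k => by
    rw [hww', pol_typeMat_map h2]
    simp
  have hind : LinearIndependent K fun j : Fin s' => w (Sum.inr j) :=
    linearIndependent_of_isAniso_diagonal hd
      (fun j => by rw [hw, quad_single_one]; simp [typeMat])
      (fun j k => by rw [htt, pol_diagonal, h2K, zero_mul])
  have hperp : ∀ (k : Fin 2) (j : Fin s'), pol A (w (Sum.inl k)) (w (Sum.inr j)) = 0 :=
    fun k j => by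
      rw [hww', pol_typeMat_map h2]
      simp
  have hfin := pol_eq_zero_of_perp_of_card_le (hPf.nondegenerate hA) hind htt
    (by rw [hcard, Fintype.card_fin, pow_succ]; omega) (hperp 0) (hperp 1)
  rw [hww', pol_typeMat_map h2] at hfin
  simp [ha] at hfin

end Contradiction

end MatForm

theorem stmt18 (F : Type) [Field F] [CharP F 2] (n : ℕ) (hn : 1 ≤ n)
    (s s' : ℕ) (hdim : 2 + s = 2 ^ n + 1) (hdim' : 2 + s' > 2 ^ n + 1)
    (φ : QuadraticForm F (Fin (2 + s) → F)) (hφa : φ.Anisotropic)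
    (hφt : HasTypeRS φ 1 s)
    (ψ : QuadraticForm F (Fin (2 + s') → F)) (hψa : ψ.Anisotropic)
    (hψt : HasTypeRS ψ 1 s') :
    (extendQF F (funFieldMap F ψ) φ).Anisotropic := by
  by_contra hcon
  obtain ⟨a₀, b₀, c₀, Eφ, hEφ⟩ := MatForm.exists_typeMat hφt
  obtain ⟨a, b, c, Eψ, hEψ⟩ := MatForm.exists_typeMat hψt
  have hφ := MatForm.isAniso_of_anisotropic Eφ hEφ hφa
  have hψ := MatForm.isAniso_of_anisotropic Eψ hEψ hψa
  exact MatForm.not_exists_linear (CharTwo.two_eq_zero) hn hdim hdim' hφ hψ fun _ _ f y w =>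
    MatForm.exists_linear_of_not_anisotropic Eφ hEφ hψ.left_ne_zero_of_typeMat Eψ hEψ hcon f y w
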